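/- arXiv:2408.01741 — 10 statements merged into one kernel-verified Lean document; each statement's English description precedes it below -/
import Mathlib

section
/- Let $m,n$ be positive integers with $m>n$. For every $(a,b,c)\in\mathbb{R}^3$ one has $\vertiii{(a,b,c)}_{m,n}=\max\{\|(a,b,c)\|_{m,m-n},\;\|(c,b,a)\|_{m,n}\}$. -/
open Set

/-- The homogeneous trinomial norm `⦀(a,b,c)⦀_{m,n}`:
the sup of `|a x^m + b x^{m-n} y^n + c y^m|` over the unit square. -/
noncomputable def homNorm (m n : ℕ) (a b c : ℝ) : ℝ :=
  sSup ((fun p : ℝ × ℝ => |a * p.1 ^ m + b * p.1 ^ (m - n) * p.2 ^ n + c * p.2 ^ m|) ''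
    (Icc (-1 : ℝ) 1 ×ˢ Icc (-1 : ℝ) 1))

/-- The trinomial norm on the line `‖(a,b,c)‖_{m,n}`:
the sup of `|a x^m + b x^n + c|` over `[-1,1]`. -/
noncomputable def lineNorm (m n : ℕ) (a b c : ℝ) : ℝ :=
  sSup ((fun x : ℝ => |a * x ^ m + b * x ^ n + c|) '' Icc (-1 : ℝ) 1)

theorem abs_trinomial_le_lineNorm (m n : ℕ) (a b c : ℝ) {x : ℝ} (hx : x ∈ Icc (-1 : ℝ) 1) :
    |a * x ^ m + b * x ^ n + c| ≤ lineNorm m n a b c :=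
  le_csSup (isCompact_Icc.image (by fun_prop)).bddAbove (mem_image_of_mem _ hx)

theorem abs_homTrinomial_le_homNorm (m n : ℕ) (a b c : ℝ) {x y : ℝ}
    (hx : x ∈ Icc (-1 : ℝ) 1) (hy : y ∈ Icc (-1 : ℝ) 1) :
    |a * x ^ m + b * x ^ (m - n) * y ^ n + c * y ^ m| ≤ homNorm m n a b c :=
  le_csSup ((isCompact_Icc.prod isCompact_Icc).image (by fun_prop)).bddAbove
    (mem_image_of_mem (fun p : ℝ × ℝ => |a * p.1 ^ m + b * p.1 ^ (m - n) * p.2 ^ n + c * p.2 ^ m|)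
      (mk_mem_prod hx hy))

theorem lineNorm_le {m n : ℕ} {a b c M : ℝ}
    (h : ∀ x ∈ Icc (-1 : ℝ) 1, |a * x ^ m + b * x ^ n + c| ≤ M) : lineNorm m n a b c ≤ M :=
  csSup_le (Nonempty.image _ ⟨0, by norm_num⟩) (forall_mem_image.2 h)

/-- Dehomogenize by dividing by the variable of larger absolute value. -/
theorem abs_homTrinomial_le_lineNorm (k l : ℕ) (a b c : ℝ) {x y : ℝ}
    (hxy : |x| ≤ |y|) (hy : |y| ≤ 1) :
    |a * x ^ (k + l) + b * x ^ k * y ^ l + c * y ^ (k + l)| ≤ lineNorm (k + l) k a b c := by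
  have h0 : 0 ≤ lineNorm (k + l) k a b c :=
    (abs_nonneg _).trans (abs_trinomial_le_lineNorm (k + l) k a b c (x := 0) (by norm_num))
  obtain ⟨t, ht, rfl⟩ : ∃ t, |t| ≤ 1 ∧ x = t * y := by
    rcases eq_or_ne y 0 with rfl | hy0
    · exact ⟨0, by simp, by simpa using hxy⟩
    · refine ⟨x / y, ?_, by field_simp⟩
      rw [abs_div]
      exact div_le_one_of_le₀ hxy (abs_nonneg y)
  calc |a * (t * y) ^ (k + l) + b * (t * y) ^ k * y ^ l + c * y ^ (k + l)|
      = |y| ^ (k + l) * |a * t ^ (k + l) + b * t ^ k + c| := by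
        rw [← abs_pow, ← abs_mul]
        ring_nf
    _ ≤ 1 * lineNorm (k + l) k a b c := by
        gcongr
        · exact pow_le_one₀ (abs_nonneg y) hy
        · exact abs_trinomial_le_lineNorm _ _ a b c (abs_le.1 ht)
    _ = lineNorm (k + l) k a b c := one_mul _

theorem stmt0 (m n : ℕ) (hn : 0 < n) (hmn : n < m) (a b c : ℝ) :
    homNorm m n a b c = max (lineNorm m (m - n) a b c) (lineNorm m n c b a) := by
  apply le_antisymm
  · refine csSup_le (Nonempty.image _ ⟨(0, 0), by simp⟩) (forall_mem_image.2 ?_)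
    rintro ⟨x, y⟩ ⟨hx, hy⟩
    obtain ⟨k, rfl⟩ := Nat.exists_eq_add_of_le' hmn.le
    simp only [Nat.add_sub_cancel]
    rcases le_total |x| |y| with h | h
    · exact (abs_homTrinomial_le_lineNorm k n a b c h (abs_le.2 hy)).trans
        (le_max_left _ _)
    · refine le_trans (le_of_eq ?_) ((abs_homTrinomial_le_lineNorm n k c b a h
        (abs_le.2 hx)).trans ?_)
      · congr 1
        ring
      · rw [Nat.add_comm n k]
        exact le_max_right _ _
  · have h1 : (1 : ℝ) ∈ Icc (-1 : ℝ) 1 := by norm_num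
    refine max_le (lineNorm_le fun x hx => ?_) (lineNorm_le fun x hx => ?_)
    · simpa using abs_homTrinomial_le_homNorm m n a b c hx h1
    · refine le_trans (le_of_eq ?_) (abs_homTrinomial_le_homNorm m n a b c h1 hx)
      congr 1
      simp only [one_pow]
      ring
end

section
/- Let $m,n$ be positive integers with $m>n$. There exist real numbers $\lambda_0\in(-\tfrac{n}{m},0)$ and $\lambda_1>0$ such that the set of real solutions of the equation $|n+mx|=(m-n)|x|^{m/(m-n)}$ is exactly $\{-1,\lambda_0,\lambda_1\}$; moreover, for every real $x\neq -1$ one has $|n+mx|<(m-n)|x|^{m/(m-n)}$ if and only if $x<\lambda_0$ or $x>\lambda_1$. -/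
open Set

/-- The tangent line of `c * t ^ p` at `t = 1` lies strictly below the graph elsewhere. -/
lemma mul_sub_lt_mul_rpow {c m p t : ℝ} (hc : 0 < c) (hp : 1 < p) (hcp : c * p = m)
    (ht : 0 ≤ t) (ht1 : t ≠ 1) : m * t - (m - c) < c * t ^ p := by
  have h := one_add_mul_self_lt_rpow_one_add (s := t - 1) (by linarith) (sub_ne_zero.2 ht1) hp
  rw [add_sub_cancel] at h
  have h2 := mul_lt_mul_of_pos_left h hc
  subst hcp
  linarith

/-- A line with positive slope and intercept meets `c * x ^ p` exactly once on `[0, ∞)`. -/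
lemma exists_pos_root_add_eq_mul_rpow {a c m p : ℝ} (ha : 0 < a) (hc : 0 < c) (hm : 0 < m)
    (hp : 1 < p) :
    ∃ l : ℝ, 0 < l ∧ a + m * l = c * l ^ p ∧ (∀ x, l < x → a + m * x < c * x ^ p) ∧
      ∀ x, 0 ≤ x → x < l → c * x ^ p < a + m * x := by
  obtain ⟨X, hX, hX1⟩ := (((tendsto_rpow_atTop (sub_pos.2 hp)).eventually_ge_atTop
    ((a + m) / c)).and (Filter.eventually_ge_atTop 1)).exists
  have hX0 : 0 < X := by linarith
  have hXp : a + m * X ≤ c * X ^ p := by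
    rw [div_le_iff₀ hc] at hX
    rw [Real.rpow_sub_one hX0.ne'] at hX
    have h := mul_le_mul_of_nonneg_right hX hX0.le
    have e : X ^ p / X * c * X = c * X ^ p := by field_simp
    nlinarith
  have hcont : ContinuousOn (fun x : ℝ => c * x ^ p - (a + m * x)) (Icc 0 X) := by
    have := Real.continuous_rpow_const (by linarith : 0 ≤ p)
    fun_prop
  obtain ⟨l, hl, hl0⟩ := intermediate_value_Icc hX0.le hcont
    (show (0 : ℝ) ∈ Icc _ _ from
      ⟨by simp [Real.zero_rpow (by linarith : p ≠ 0), ha.le], sub_nonneg.2 hXp⟩)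
  have hroot : a + m * l = c * l ^ p := (sub_eq_zero.1 hl0).symm
  have hlpos : 0 < l := by
    refine hl.1.lt_of_ne ?_
    rintro rfl
    rw [Real.zero_rpow (by linarith)] at hroot
    linarith
  have hscale : ∀ x, 0 ≤ x → c * x ^ p = (a + m * l) * (x / l) ^ p := fun x hx => by
    have := Real.rpow_pos_of_pos hlpos p
    rw [hroot, Real.div_rpow hx hlpos.le]
    field_simp
  have hlin : ∀ x, m * l * (x / l) = m * x := fun x => by field_simp
  have hpos : 0 < a + m * l := by positivity
  refine ⟨l, hlpos, hroot, fun x hx => ?_, fun x hx0 hx => ?_⟩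
  · rw [hscale x (by linarith)]
    have hs : 1 < x / l := (one_lt_div hlpos).2 hx
    have h := mul_lt_mul_of_pos_left (Real.self_lt_rpow_of_one_lt hs hp) hpos
    nlinarith [hlin x]
  · rw [hscale x hx0]
    have hs : x / l < 1 := (div_lt_one hlpos).2 hx
    have h := mul_le_mul_of_nonneg_left
      (Real.rpow_le_self_of_le_one (by positivity) hs.le hp.le) hpos.le
    nlinarith [hlin x]

/-- A line with negative slope and positive intercept meets `c * t ^ p` exactly once on `[0, ∞)`. -/
lemma exists_pos_root_sub_eq_mul_rpow {a c m p : ℝ} (ha : 0 < a) (hc : 0 < c) (hm : 0 < m)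
    (hp : 1 < p) :
    ∃ l : ℝ, 0 < l ∧ l < a / m ∧ a - m * l = c * l ^ p ∧
      (∀ t, l < t → a - m * t < c * t ^ p) ∧
      ∀ t, 0 ≤ t → t < l → c * t ^ p < a - m * t := by
  have hcont : ContinuousOn (fun x : ℝ => c * x ^ p - (a - m * x)) (Icc 0 (a / m)) := by
    have := Real.continuous_rpow_const (by linarith : 0 ≤ p)
    fun_prop
  have ham : 0 < a / m := by positivity
  have hend : m * (a / m) = a := by field_simp
  obtain ⟨l, hl, hl0⟩ := intermediate_value_Ioo ham.le hcont
    (show (0 : ℝ) ∈ Ioo _ _ from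
      ⟨by simp [Real.zero_rpow (by linarith : p ≠ 0), ha], by
        have : 0 < c * (a / m) ^ p := by positivity
        simpa [hend] using this⟩)
  have hroot : a - m * l = c * l ^ p := (sub_eq_zero.1 hl0).symm
  refine ⟨l, hl.1, hl.2, hroot, fun t ht => ?_, fun t ht0 ht => ?_⟩
  · have h := mul_lt_mul_of_pos_left
      (Real.rpow_lt_rpow hl.1.le ht (by linarith : 0 < p)) hc
    nlinarith
  · have h := mul_lt_mul_of_pos_left (Real.rpow_lt_rpow ht0 ht (by linarith : 0 < p)) hc
    nlinarith

theorem stmt2 (m n : ℕ) (hn : 0 < n) (hmn : n < m) :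
    ∃ lam0 lam1 : ℝ, lam0 ∈ Ioo (-((n : ℝ) / m)) 0 ∧ 0 < lam1 ∧
      {x : ℝ | |(n : ℝ) + m * x| = ((m : ℝ) - n) * |x| ^ ((m : ℝ) / ((m : ℝ) - n))} =
        {-1, lam0, lam1} ∧
      ∀ x : ℝ, x ≠ -1 →
        (|(n : ℝ) + m * x| < ((m : ℝ) - n) * |x| ^ ((m : ℝ) / ((m : ℝ) - n)) ↔
          x < lam0 ∨ lam1 < x) := by
  have ha : (0 : ℝ) < n := by exact_mod_cast hn
  have hc : (0 : ℝ) < (m : ℝ) - n := sub_pos.2 (by exact_mod_cast hmn)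
  have hm : (0 : ℝ) < m := by linarith
  have hp : 1 < (m : ℝ) / ((m : ℝ) - n) := (one_lt_div hc).2 (by linarith)
  have hcp : ((m : ℝ) - n) * ((m : ℝ) / ((m : ℝ) - n)) = m := by field_simp
  generalize (m : ℝ) / ((m : ℝ) - n) = p at hp hcp ⊢
  obtain ⟨l, hl, hlam, hlroot, hlgt, hllt⟩ := exists_pos_root_sub_eq_mul_rpow ha hc hm hp
  obtain ⟨k, hk, hkroot, hkgt, hklt⟩ := exists_pos_root_add_eq_mul_rpow ha hc hm hp
  have hlm : m * l < n := by rwa [lt_div_iff₀' hm] at hlam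
  have hl1 : l < 1 := by nlinarith
  have hm1 : |(n : ℝ) + m * (-1)| = ((m : ℝ) - n) * |(-1 : ℝ)| ^ p := by
    rw [abs_neg, abs_one, Real.one_rpow, abs_of_neg (by linarith)]
    ring
  have hl' : |(n : ℝ) + m * (-l)| = ((m : ℝ) - n) * |-l| ^ p := by
    rw [abs_neg, abs_of_pos hl, ← hlroot, abs_of_pos (by linarith)]
    ring
  have hk' : |(n : ℝ) + m * k| = ((m : ℝ) - n) * |k| ^ p := by
    rw [abs_of_pos hk, ← hkroot, abs_of_pos (by positivity)]
  have hlt : ∀ x : ℝ, x ≠ -1 → x < -l ∨ k < x →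
      |(n : ℝ) + m * x| < ((m : ℝ) - n) * |x| ^ p := by
    rintro x hx (h | h)
    · have ht := mul_sub_lt_mul_rpow (t := -x) hc hp hcp (by linarith) fun e => hx (by linarith)
      have hg := hlgt (-x) (by linarith)
      rw [abs_of_neg (by linarith : x < 0), abs_lt]
      constructor <;> linarith
    · have hx0 : 0 < x := hk.trans h
      rw [abs_of_pos hx0, abs_of_pos (by positivity)]
      exact hkgt x h
  have hgt : ∀ x : ℝ, -l < x → x < k →
      ((m : ℝ) - n) * |x| ^ p < |(n : ℝ) + m * x| := by
    intro x h1 h2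
    refine lt_of_lt_of_le ?_ (le_abs_self _)
    rcases le_total 0 x with h | h
    · rw [abs_of_nonneg h]
      exact hklt x h h2
    · rw [abs_of_nonpos h]
      have := hllt (-x) (by linarith) (by linarith)
      linarith
  refine ⟨-l, k, ⟨by linarith, by linarith⟩, hk, ?_, fun x hx => ⟨fun h => ?_, hlt x hx⟩⟩
  · ext x
    simp only [mem_ofPred_eq, mem_insert_iff, mem_singleton_iff]
    refine ⟨fun h => ?_, ?_⟩
    · by_contra! hne
      obtain ⟨h1, h2, h3⟩ := hne
      rcases lt_or_gt_of_ne h2 with h4 | h4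
      · exact (hlt x h1 (.inl h4)).ne h
      rcases lt_or_gt_of_ne h3 with h5 | h5
      · exact (hgt x h4 h5).ne' h
      · exact (hlt x h1 (.inr h5)).ne h
    · rintro (rfl | rfl | rfl)
      exacts [hm1, hl', hk']
  · by_contra! hne
    rcases hne.1.eq_or_lt with rfl | h1
    · exact h.ne hl'
    rcases hne.2.eq_or_lt with rfl | h2
    · exact h.ne hk'
    exact (hgt x h1 h2).not_gt h
end

section
/- Let $m,n$ be positive integers with $m>n$, $m$ odd and $n$ even, and let $\mu_0\in(-\tfrac{m-n}{m},0)$ be a real number satisfying $|(m-n)+m\mu_0|=n|\mu_0|^{m/n}$. Set $K_{m,n}=\tfrac{n}{m-n}(\tfrac{m-n}{m})^{m/n}$, $\eta_1=-\tfrac{m}{m-n}$, $\eta_2=\tfrac{m}{m-n}\mu_0$, $I_{m,n}=[\eta_1,\eta_2]$, and define $A_{m,n}=\{(x,y)\in\mathbb{R}^2:x\in I_{m,n},\ |y|\ge 1-K_{m,n}|x|^{m/n}\}$, $F_{m,n}=\{(x,y)\in\mathbb{R}^2:x\in I_{m,n},\ 1-K_{m,n}|x|^{m/n}<|y|<1-|1+x|\}$,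 $\mathcal{B}=\{(x,y)\in\mathbb{R}^2:|x+1|+|y|<1\}$ and $B_{m,n}=\mathcal{B}\setminus F_{m,n}$. Then for every $(a,b,c)\in\mathbb{R}^3$: $\vertiii{(a,b,c)}_{m,n}=\tfrac{n|a|}{m-n}\,|\tfrac{(m-n)b}{ma}|^{m/n}+|c|$ if $a\neq 0$ and $(\tfrac{b}{a},\tfrac{c}{a})\in A_{m,n}$; $\vertiii{(a,b,c)}_{m,n}=|a|$ if $a\neq 0$ and $(\tfrac{b}{a},\tfrac{c}{a})\in B_{m,n}$; and $\vertiii{(a,b,c)}_{m,n}=|a+b|+|c|$ otherwise. -/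
open Set

/-- The constant `K_{m,n} = n/(m-n) · ((m-n)/m)^{m/n}`. -/
noncomputable def Kc (m n : ℕ) : ℝ :=
  (n : ℝ) / ((m : ℝ) - n) * (((m : ℝ) - n) / m) ^ ((m : ℝ) / n)

/-- `η₁ = -m/(m-n)`. -/
noncomputable def eta1 (m n : ℕ) : ℝ := -((m : ℝ) / ((m : ℝ) - n))

/-- `η₂ = (m/(m-n)) μ₀`. -/
noncomputable def eta2 (m n : ℕ) (μ0 : ℝ) : ℝ := (m : ℝ) / ((m : ℝ) - n) * μ0

/-- The region `A_{m,n}`. -/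
noncomputable def Aregion (m n : ℕ) (μ0 : ℝ) : Set (ℝ × ℝ) :=
  {p | p.1 ∈ Icc (eta1 m n) (eta2 m n μ0) ∧ 1 - Kc m n * |p.1| ^ ((m : ℝ) / n) ≤ |p.2|}

/-- The region `F_{m,n}`. -/
noncomputable def Fregion (m n : ℕ) (μ0 : ℝ) : Set (ℝ × ℝ) :=
  {p | p.1 ∈ Icc (eta1 m n) (eta2 m n μ0) ∧
    1 - Kc m n * |p.1| ^ ((m : ℝ) / n) < |p.2| ∧ |p.2| < 1 - |1 + p.1|}

/-- The open region `𝓑`. -/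
def calB : Set (ℝ × ℝ) := {p | |p.1 + 1| + |p.2| < 1}

/-- The region `B_{m,n} = 𝓑 \ F_{m,n}`. -/
noncomputable def Bregion (m n : ℕ) (μ0 : ℝ) : Set (ℝ × ℝ) := calB \ Fregion m n μ0

/-- Weighted arithmetic-geometric mean inequality, as the tangent line bound for `u ↦ u ^ (m / n)`
at the point `s ^ n`. -/
lemma pow_mul_sub_le_rpow {m n : ℕ} (hn0 : 0 < n) (hmn : n < m) {u s : ℝ} (hu : 0 ≤ u)
    (hs : 0 ≤ s) :
    s ^ (m - n) * (m * u - ((m : ℝ) - n) * s ^ n) ≤ n * u ^ ((m : ℝ) / n) := by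
  have hn : (0 : ℝ) < n := by exact_mod_cast hn0
  have hr : 1 ≤ (m : ℝ) / n := by
    rw [le_div_iff₀ hn, one_mul]
    exact_mod_cast hmn.le
  rcases hs.eq_or_lt with rfl | hs
  · rw [zero_pow (by omega : m - n ≠ 0), zero_mul]
    positivity
  have hsn : 0 < s ^ n := by positivity
  have hpow : (s ^ n) ^ ((m : ℝ) / n) = s ^ m := by
    rw [← Real.rpow_natCast s n, ← Real.rpow_mul hs.le, mul_div_cancel₀ _ hn.ne',
      Real.rpow_natCast]
  have hsm : s ^ m = s ^ (m - n) * s ^ n := by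
    rw [← pow_add, Nat.sub_add_cancel hmn.le]
  have hq : 0 ≤ u / s ^ n := by positivity
  have hbern := one_add_mul_self_le_rpow_one_add (s := u / s ^ n - 1) (by linarith) hr
  rw [add_sub_cancel, Real.div_rpow hu hsn.le, hpow, le_div_iff₀ (by positivity), hsm] at hbern
  calc s ^ (m - n) * (m * u - ((m : ℝ) - n) * s ^ n)
      = n * ((1 + (m : ℝ) / n * (u / s ^ n - 1)) * (s ^ (m - n) * s ^ n)) := by
        field_simp
        ring
    _ ≤ n * u ^ ((m : ℝ) / n) := by gcongr

lemma Kc_mul_abs_rpow {m n : ℕ} (hmn : n < m) (β : ℝ) :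
    Kc m n * |β| ^ ((m : ℝ) / n) =
      n / ((m : ℝ) - n) * |((m : ℝ) - n) / m * β| ^ ((m : ℝ) / n) := by
  have hD : (0 : ℝ) < (m : ℝ) - n := sub_pos.2 (by exact_mod_cast hmn)
  have hq : 0 ≤ ((m : ℝ) - n) / m := by positivity
  rw [Kc, abs_mul, abs_of_nonneg hq, Real.mul_rpow hq (abs_nonneg _)]
  ring

lemma abs_trinomial_le {m n : ℕ} (hm : Odd m) (hn : Even n) (hmn : n < m) (a b c x y : ℝ) :
    |a * x ^ m + b * x ^ (m - n) * y ^ n + c * y ^ m| ≤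
      |a * |x| ^ m + b * |x| ^ (m - n) * |y| ^ n| + |c| * |y| ^ m := by
  have hodd : Odd (m - n) := Nat.Odd.sub_even hmn.le hm hn
  have hx : |a * x ^ m + b * x ^ (m - n) * y ^ n| =
      |a * |x| ^ m + b * |x| ^ (m - n) * |y| ^ n| := by
    rw [hn.pow_abs]
    rcases abs_choice x with h | h <;> rw [h]
    rw [hm.neg_pow, hodd.neg_pow, ← abs_neg]
    congr 1
    ring
  calc |a * x ^ m + b * x ^ (m - n) * y ^ n + c * y ^ m|
      ≤ |a * x ^ m + b * x ^ (m - n) * y ^ n| + |c * y ^ m| := abs_add_le _ _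
    _ = _ := by rw [hx, abs_mul, abs_pow]

lemma abs_trinomial_le_of_bound {m n : ℕ} (hmn : n < m) {a b c V : ℝ} (ha : |a| ≤ V)
    (hV : ∀ s ∈ Icc (0 : ℝ) 1, |a * s ^ m + b * s ^ (m - n)| + |c| ≤ V)
    {x y : ℝ} (hx : x ∈ Icc (0 : ℝ) 1) (hy : y ∈ Icc (0 : ℝ) 1) :
    |a * x ^ m + b * x ^ (m - n) * y ^ n| + |c| * y ^ m ≤ V := by
  have hV0 : 0 ≤ V := (abs_nonneg a).trans ha
  have hm0 : m ≠ 0 := by omega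
  have hmn0 : m - n ≠ 0 := by omega
  have hsplit : ∀ z : ℝ, z ^ m = z ^ (m - n) * z ^ n := fun z => by
    rw [← pow_add, Nat.sub_add_cancel hmn.le]
  rcases le_total x y with hxy | hyx
  · rcases hy.1.eq_or_lt with rfl | hy0
    · obtain rfl : x = 0 := le_antisymm hxy hx.1
      simpa [zero_pow hm0, zero_pow hmn0] using hV0
    obtain ⟨s, rfl⟩ : ∃ s, x = s * y := ⟨x / y, by field_simp⟩
    have hs : s ∈ Icc (0 : ℝ) 1 :=
      ⟨by nlinarith [hx.1], by nlinarith⟩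
    have hym : y ^ m ≤ 1 := pow_le_one₀ hy.1 hy.2
    have hym0 : 0 ≤ y ^ m := pow_nonneg hy.1 _
    calc |a * (s * y) ^ m + b * (s * y) ^ (m - n) * y ^ n| + |c| * y ^ m
        = (|a * s ^ m + b * s ^ (m - n)| + |c|) * y ^ m := by
          have e : a * (s * y) ^ m + b * (s * y) ^ (m - n) * y ^ n =
              (a * s ^ m + b * s ^ (m - n)) * y ^ m := by
            rw [mul_pow, mul_pow, hsplit y]
            ring
          rw [e, abs_mul, abs_of_nonneg hym0, add_mul]
      _ ≤ V * y ^ m := by gcongr; exact hV s hs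
      _ ≤ V := mul_le_of_le_one_right hV0 hym
  · rcases hx.1.eq_or_lt with rfl | hx0
    · obtain rfl : y = 0 := le_antisymm hyx hy.1
      simpa [zero_pow hm0, zero_pow hmn0] using hV0
    obtain ⟨s, rfl⟩ : ∃ s, y = s * x := ⟨y / x, by field_simp⟩
    have hs : s ∈ Icc (0 : ℝ) 1 :=
      ⟨by nlinarith [hy.1], by nlinarith⟩
    have hxm : x ^ m ≤ 1 := pow_le_one₀ hx.1 hx.2
    have hxm0 : 0 ≤ x ^ m := pow_nonneg hx.1 _
    have hw0 : 0 ≤ s ^ n := pow_nonneg hs.1 _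
    have hw1 : s ^ n ≤ 1 := pow_le_one₀ hs.1 hs.2
    have hsm : s ^ m ≤ s ^ n := pow_le_pow_of_le_one hs.1 hs.2 hmn.le
    have h1 : |a + b| + |c| ≤ V := by simpa using hV 1 ⟨zero_le_one, le_rfl⟩
    have hconv : |a + b * s ^ n| ≤ (1 - s ^ n) * |a| + s ^ n * |a + b| := by
      calc |a + b * s ^ n| = |(1 - s ^ n) * a + s ^ n * (a + b)| := by congr 1; ring
        _ ≤ |(1 - s ^ n) * a| + |s ^ n * (a + b)| := abs_add_le _ _
        _ = _ := by rw [abs_mul, abs_mul, abs_of_nonneg (sub_nonneg.2 hw1), abs_of_nonneg hw0]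
    have hle : |a + b * s ^ n| + |c| * s ^ m ≤ V := by
      have h2 := mul_le_mul_of_nonneg_left hsm (abs_nonneg c)
      have h3 := mul_le_mul_of_nonneg_left h1 hw0
      have h4 := mul_le_mul_of_nonneg_left ha (sub_nonneg.2 hw1)
      linarith
    calc |a * x ^ m + b * x ^ (m - n) * (s * x) ^ n| + |c| * (s * x) ^ m
        = (|a + b * s ^ n| + |c| * s ^ m) * x ^ m := by
          have e : a * x ^ m + b * x ^ (m - n) * (s * x) ^ n = (a + b * s ^ n) * x ^ m := by
            rw [mul_pow, hsplit x]
            ring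
          rw [e, abs_mul, abs_of_nonneg hxm0, mul_pow]
          ring
      _ ≤ V * x ^ m := by gcongr
      _ ≤ V := mul_le_of_le_one_right hV0 hxm

/-- Reduction of the norm to a one-variable maximum. -/
lemma homNorm_eq_of_isMax {m n : ℕ} (hm : Odd m) (hn : Even n) (hn0 : 0 < n) (hmn : n < m)
    {a b c V : ℝ} (ha : |a| ≤ V)
    (hV : ∀ s ∈ Icc (0 : ℝ) 1, |a * s ^ m + b * s ^ (m - n)| + |c| ≤ V)
    (hat : V = |a| ∨ ∃ s ∈ Icc (0 : ℝ) 1, V = |a * s ^ m + b * s ^ (m - n)| + |c|) :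
    homNorm m n a b c = V := by
  refine IsGreatest.csSup_eq ⟨?_, ?_⟩
  · rcases hat with rfl | ⟨s, hs, rfl⟩
    · exact ⟨(1, 0), by simp, by simp [hn0.ne', zero_pow (hn0.trans hmn).ne']⟩
    · have hs' : s ∈ Icc (-1 : ℝ) 1 := ⟨by linarith [hs.1], hs.2⟩
      by_cases h : (0 ≤ a * s ^ m + b * s ^ (m - n)) ↔ 0 ≤ c
      · refine ⟨(s, 1), ⟨hs', by simp⟩, ?_⟩
        simp only [one_pow, mul_one]
        rw [abs_add_eq_add_abs_iff]
        by_cases hc : 0 ≤ c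
        · exact Or.inl ⟨h.2 hc, hc⟩
        · exact Or.inr ⟨(not_le.1 fun h' => hc (h.1 h')).le, (not_le.1 hc).le⟩
      · refine ⟨(s, -1), ⟨hs', by simp⟩, ?_⟩
        simp only [hm.neg_one_pow, hn.neg_one_pow, mul_one]
        rw [← abs_neg c, show c * -1 = -c by ring, abs_add_eq_add_abs_iff]
        by_cases hc : 0 ≤ c
        · refine Or.inr ⟨?_, by linarith⟩
          by_contra h'
          exact h (iff_of_true (not_le.1 h').le hc)
        · refine Or.inl ⟨?_, by linarith⟩
          by_contra h'
          exact h (iff_of_false h' hc)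
  · rintro _ ⟨⟨x, y⟩, ⟨hx, hy⟩, rfl⟩
    exact (abs_trinomial_le hm hn hmn a b c x y).trans
      (abs_trinomial_le_of_bound hmn ha hV ⟨abs_nonneg x, abs_le.2 hx⟩ ⟨abs_nonneg y, abs_le.2 hy⟩)

/-- The critical value bound for `s ^ m + β s ^ (m - n)` when `β ≤ 0`. -/
lemma abs_pow_add_le_of_nonpos {m n : ℕ} (hn0 : 0 < n) (hmn : n < m) {β T : ℝ} (hβ : β ≤ 0)
    (h1 : |1 + β| ≤ T) (hK : Kc m n * |β| ^ ((m : ℝ) / n) ≤ T) {s : ℝ} (hs : s ∈ Icc (0 : ℝ) 1) :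
    |s ^ m + β * s ^ (m - n)| ≤ T := by
  have hm : (0 : ℝ) < m := by exact_mod_cast hn0.trans hmn
  have hD : (0 : ℝ) < (m : ℝ) - n := sub_pos.2 (by exact_mod_cast hmn)
  have hsm : s ^ m = s ^ (m - n) * s ^ n := by
    rw [← pow_add, Nat.sub_add_cancel hmn.le]
  have hp0 : 0 ≤ s ^ (m - n) := pow_nonneg hs.1 _
  have hp1 : s ^ (m - n) ≤ 1 := pow_le_one₀ hs.1 hs.2
  have hw1 : s ^ n ≤ 1 := pow_le_one₀ hs.1 hs.2
  have hT : 0 ≤ T := (abs_nonneg _).trans h1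
  rw [abs_le]
  constructor
  · rw [Kc_mul_abs_rpow hmn, abs_of_nonpos (mul_nonpos_of_nonneg_of_nonpos (by positivity) hβ)] at hK
    have hu : 0 ≤ -(((m : ℝ) - n) / m * β) :=
      neg_nonneg.2 (mul_nonpos_of_nonneg_of_nonpos (by positivity) hβ)
    have h := pow_mul_sub_le_rpow hn0 hmn hu hs.1
    rw [div_mul_eq_mul_div, div_le_iff₀ hD] at hK
    have e : (m : ℝ) * -(((m : ℝ) - n) / m * β) = -(((m : ℝ) - n) * β) := by field_simp
    rw [e] at h
    have h2 : ((m : ℝ) - n) * (-(s ^ m + β * s ^ (m - n))) ≤ ((m : ℝ) - n) * T := by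
      rw [hsm]
      linarith
    linarith [le_of_mul_le_mul_left h2 hD]
  · rw [hsm]
    rcases le_total (s ^ n + β) 0 with h | h
    · nlinarith
    · have := (abs_le.1 h1).2
      nlinarith

lemma abs_one_add_le_Kc_mul {m n : ℕ} (hn0 : 0 < n) (hmn : n < m) {μ0 : ℝ}
    (hμ0 : μ0 ∈ Ioo (-(((m : ℝ) - n) / m)) 0)
    (hμ0eq : |((m : ℝ) - n) + m * μ0| = n * |μ0| ^ ((m : ℝ) / n)) {β : ℝ}
    (hβ : β ≤ eta2 m n μ0) :
    |1 + β| ≤ Kc m n * |β| ^ ((m : ℝ) / n) := by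
  have hm : (0 : ℝ) < m := by exact_mod_cast hn0.trans hmn
  have hD : (0 : ℝ) < (m : ℝ) - n := sub_pos.2 (by exact_mod_cast hmn)
  obtain ⟨v, rfl⟩ : ∃ v, β = (m : ℝ) / (m - n) * v := ⟨((m : ℝ) - n) / m * β, by field_simp⟩
  have hv : v ≤ μ0 := le_of_mul_le_mul_left hβ (by positivity)
  have e : ((m : ℝ) - n) / m * ((m : ℝ) / (m - n) * v) = v := by field_simp
  rw [Kc_mul_abs_rpow hmn, e, div_mul_eq_mul_div (n : ℝ), le_div_iff₀ hD, ← abs_of_pos hD, ← abs_mul,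
    abs_of_pos hD]
  have e2 : (1 + (m : ℝ) / (m - n) * v) * ((m : ℝ) - n) = (m - n) + m * v := by
    field_simp
  rw [e2]
  have hmon : |μ0| ^ ((m : ℝ) / n) ≤ |v| ^ ((m : ℝ) / n) := by
    refine Real.rpow_le_rpow (abs_nonneg _) ?_ (by positivity)
    rw [abs_of_neg hμ0.2, abs_of_neg (hv.trans_lt hμ0.2)]
    linarith
  have hmon' := mul_le_mul_of_nonneg_left hmon (Nat.cast_nonneg (α := ℝ) n)
  have hle := (le_abs_self _).trans hμ0eq.le
  have hmul := mul_le_mul_of_nonneg_left hv hm.le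
  have h := pow_mul_sub_le_rpow hn0 hmn (abs_nonneg v) zero_le_one
  rw [one_pow, one_pow, one_mul, mul_one, abs_of_neg (hv.trans_lt hμ0.2)] at h
  rw [abs_of_neg (hv.trans_lt hμ0.2)] at hmon' ⊢
  rw [abs_le]
  constructor <;> linarith

lemma abs_pow_add_le_of_notMem {m n : ℕ} (hn0 : 0 < n) (hmn : n < m) {μ0 : ℝ}
    (hμ0 : μ0 ∈ Ioo (-(((m : ℝ) - n) / m)) 0)
    (hμ0eq : |((m : ℝ) - n) + m * μ0| = n * |μ0| ^ ((m : ℝ) / n)) {β : ℝ}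
    (hβ : β ∉ Icc (eta1 m n) (eta2 m n μ0)) {s : ℝ} (hs : s ∈ Icc (0 : ℝ) 1) :
    |s ^ m + β * s ^ (m - n)| ≤ |1 + β| := by
  have hm : (0 : ℝ) < m := by exact_mod_cast hn0.trans hmn
  have hD : (0 : ℝ) < (m : ℝ) - n := sub_pos.2 (by exact_mod_cast hmn)
  have hsm : s ^ m = s ^ (m - n) * s ^ n := by
    rw [← pow_add, Nat.sub_add_cancel hmn.le]
  have hp0 : 0 ≤ s ^ (m - n) := pow_nonneg hs.1 _
  have hp1 : s ^ (m - n) ≤ 1 := pow_le_one₀ hs.1 hs.2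
  have hq0 : 0 ≤ s ^ m := pow_nonneg hs.1 _
  have hq1 : s ^ m ≤ 1 := pow_le_one₀ hs.1 hs.2
  have hw1 : s ^ n ≤ 1 := pow_le_one₀ hs.1 hs.2
  rcases le_total 0 β with h0 | h0
  · rw [abs_of_nonneg (by positivity), abs_of_nonneg (by positivity)]
    nlinarith
  rcases lt_or_ge β (eta1 m n) with h1 | h1
  · have hb : ((m : ℝ) - n) * β ≤ -m := by
      have := mul_le_mul_of_nonneg_left h1.le hD.le
      rw [eta1] at this
      have e : ((m : ℝ) - n) * -((m : ℝ) / (m - n)) = -m := by field_simp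
      linarith
    have hn : (0 : ℝ) < n := by exact_mod_cast hn0
    have hb1 : β ≤ -1 := by nlinarith
    have h := pow_mul_sub_le_rpow hn0 hmn zero_le_one hs.1
    rw [Real.one_rpow, mul_one, mul_one] at h
    have hneg : s ^ m + β * s ^ (m - n) ≤ 0 := by
      rw [hsm]
      nlinarith
    rw [abs_of_nonpos hneg, abs_of_nonpos (by linarith)]
    have h2 : ((m : ℝ) - n) * (-(s ^ m + β * s ^ (m - n))) ≤ ((m : ℝ) - n) * (-(1 + β)) := by
      rw [hsm]
      nlinarith [mul_nonneg (sub_nonneg.2 hp1) (sub_nonneg.2 hb)]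
    exact le_of_mul_le_mul_left h2 hD
  · have h2 : eta2 m n μ0 ≤ β := (not_le.1 fun h => hβ ⟨h1, h⟩).le
    refine abs_pow_add_le_of_nonpos hn0 hmn h0 le_rfl ?_ hs
    obtain ⟨v, rfl⟩ : ∃ v, β = (m : ℝ) / (m - n) * v := ⟨((m : ℝ) - n) / m * β, by field_simp⟩
    have hv : μ0 ≤ v := le_of_mul_le_mul_left h2 (by positivity)
    have hv0 : v ≤ 0 := by
      by_contra hv0
      have : 0 < (m : ℝ) / (m - n) * v := mul_pos (by positivity) (not_le.1 hv0)
      linarith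
    have e : ((m : ℝ) - n) / m * ((m : ℝ) / (m - n) * v) = v := by field_simp
    refine le_trans ?_ (le_abs_self _)
    rw [Kc_mul_abs_rpow hmn, e, div_mul_eq_mul_div (n : ℝ), div_le_iff₀ hD]
    have e2 : (1 + (m : ℝ) / (m - n) * v) * ((m : ℝ) - n) = (m - n) + m * v := by
      field_simp
    rw [e2]
    have hmon : |v| ^ ((m : ℝ) / n) ≤ |μ0| ^ ((m : ℝ) / n) := by
      refine Real.rpow_le_rpow (abs_nonneg _) ?_ (by positivity)
      rw [abs_of_neg hμ0.2, abs_of_nonpos hv0]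
      linarith
    have hmon' := mul_le_mul_of_nonneg_left hmon (Nat.cast_nonneg (α := ℝ) n)
    have hpos : 0 ≤ ((m : ℝ) - n) + m * μ0 := by
      have := hμ0.1
      rw [← neg_div, div_lt_iff₀ hm] at this
      linarith
    rw [abs_of_nonneg hpos] at hμ0eq
    have hmul := mul_le_mul_of_nonneg_left hv hm.le
    linarith

/-- The critical value is attained in `[0, 1]`. -/
lemma exists_abs_pow_add_eq_Kc_mul {m n : ℕ} (hn0 : 0 < n) (hmn : n < m) {β : ℝ}
    (h1 : eta1 m n ≤ β) (h0 : β ≤ 0) :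
    ∃ s ∈ Icc (0 : ℝ) 1, |s ^ m + β * s ^ (m - n)| = Kc m n * |β| ^ ((m : ℝ) / n) := by
  have hm : (0 : ℝ) < m := by exact_mod_cast hn0.trans hmn
  have hn : (0 : ℝ) < n := by exact_mod_cast hn0
  have hD : (0 : ℝ) < (m : ℝ) - n := sub_pos.2 (by exact_mod_cast hmn)
  obtain ⟨u, rfl⟩ : ∃ u, β = -((m : ℝ) / (m - n) * u) :=
    ⟨-(((m : ℝ) - n) / m * β), by field_simp⟩
  have hq : 0 < (m : ℝ) / (m - n) := by positivity
  have hu0 : 0 ≤ u := by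
    by_contra h
    nlinarith
  have hu1 : u ≤ 1 := by
    rw [eta1] at h1
    by_contra h
    nlinarith
  have hs0 : 0 ≤ u ^ ((1 : ℝ) / n) := Real.rpow_nonneg hu0 _
  refine ⟨u ^ ((1 : ℝ) / n), ⟨hs0, Real.rpow_le_one hu0 hu1 (by positivity)⟩, ?_⟩
  have e : ((m : ℝ) - n) / m * -((m : ℝ) / (m - n) * u) = -u := by field_simp
  have hsn : (u ^ ((1 : ℝ) / n)) ^ n = u := by
    rw [one_div, Real.rpow_inv_natCast_pow hu0 hn0.ne']
  have hsm : (u ^ ((1 : ℝ) / n)) ^ m = u ^ ((m : ℝ) / n) := by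
    rw [← Real.rpow_natCast, ← Real.rpow_mul hu0]
    congr 1
    ring
  have hsplit : (u ^ ((1 : ℝ) / n)) ^ m = (u ^ ((1 : ℝ) / n)) ^ (m - n) * u := by
    nth_rewrite 3 [← hsn]
    rw [← pow_add, Nat.sub_add_cancel hmn.le]
  rw [Kc_mul_abs_rpow hmn, e, abs_neg, abs_of_nonneg hu0, ← hsm, hsplit,
    ← abs_neg]
  have e2 : -((u ^ ((1 : ℝ) / n)) ^ (m - n) * u +
      -((m : ℝ) / (m - n) * u) * (u ^ ((1 : ℝ) / n)) ^ (m - n)) =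
      n / ((m : ℝ) - n) * ((u ^ ((1 : ℝ) / n)) ^ (m - n) * u) := by
    field_simp
    ring
  rw [e2, abs_of_nonneg (by positivity)]

theorem stmt3 (m n : ℕ) (hm : Odd m) (hn : Even n) (hn0 : 0 < n) (hmn : n < m)
    (μ0 : ℝ) (hμ0 : μ0 ∈ Ioo (-(((m : ℝ) - n) / m)) 0)
    (hμ0eq : |((m : ℝ) - n) + m * μ0| = n * |μ0| ^ ((m : ℝ) / n)) :
    ∀ a b c : ℝ,
      (a ≠ 0 → (b / a, c / a) ∈ Aregion m n μ0 →
        homNorm m n a b c =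
          (n : ℝ) * |a| / ((m : ℝ) - n) * |((m : ℝ) - n) * b / (m * a)| ^ ((m : ℝ) / n) + |c|) ∧
      (a ≠ 0 → (b / a, c / a) ∈ Bregion m n μ0 → homNorm m n a b c = |a|) ∧
      (¬ (a ≠ 0 ∧ (b / a, c / a) ∈ Aregion m n μ0 ∪ Bregion m n μ0) →
        homNorm m n a b c = |a + b| + |c|) := by
  intro a b c
  have hm0 : (0 : ℝ) < m := by exact_mod_cast hn0.trans hmn
  have hD : (0 : ℝ) < (m : ℝ) - n := sub_pos.2 (by exact_mod_cast hmn)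
  have heta2 : eta2 m n μ0 < 0 := mul_neg_of_pos_of_neg (by positivity) hμ0.2
  rcases eq_or_ne a 0 with rfl | ha
  · refine ⟨fun h => absurd rfl h, fun h => absurd rfl h, fun _ => ?_⟩
    refine homNorm_eq_of_isMax hm hn hn0 hmn (by rw [abs_zero]; positivity) (fun s hs => ?_)
      (Or.inr ⟨1, by simp, by simp⟩)
    rw [zero_mul, zero_add, zero_add, abs_mul, abs_of_nonneg (pow_nonneg hs.1 _)]
    gcongr
    exact mul_le_of_le_one_right (abs_nonneg b) (pow_le_one₀ hs.1 hs.2)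
  have ha' : 0 < |a| := abs_pos.2 ha
  obtain ⟨β, rfl⟩ : ∃ β, b = a * β := ⟨b / a, by field_simp⟩
  obtain ⟨γ, rfl⟩ : ∃ γ, c = a * γ := ⟨c / a, by field_simp⟩
  rw [mul_div_cancel_left₀ _ ha, mul_div_cancel_left₀ _ ha]
  have hscale : ∀ s : ℝ, |a * s ^ m + a * β * s ^ (m - n)| + |a * γ| =
      |a| * (|s ^ m + β * s ^ (m - n)| + |γ|) := fun s => by
    rw [mul_add, ← abs_mul, ← abs_mul]
    ring_nf
  have hnorm : ∀ V : ℝ, 1 ≤ V →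
      (∀ s ∈ Icc (0 : ℝ) 1, |s ^ m + β * s ^ (m - n)| + |γ| ≤ V) →
      (V = 1 ∨ ∃ s ∈ Icc (0 : ℝ) 1, |s ^ m + β * s ^ (m - n)| + |γ| = V) →
      homNorm m n a (a * β) (a * γ) = |a| * V := by
    intro V h1 hV hat
    refine homNorm_eq_of_isMax hm hn hn0 hmn (le_mul_of_one_le_right ha'.le h1) ?_ ?_
    · intro s hs
      rw [hscale]
      gcongr
      exact hV s hs
    · rcases hat with rfl | ⟨s, hs, rfl⟩
      · exact Or.inl (mul_one _)
      · exact Or.inr ⟨s, hs, (hscale s).symm⟩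
  have hout : β ∉ Icc (eta1 m n) (eta2 m n μ0) → ∀ s ∈ Icc (0 : ℝ) 1,
      |s ^ m + β * s ^ (m - n)| ≤ |1 + β| := fun h s hs =>
    abs_pow_add_le_of_notMem hn0 hmn hμ0 hμ0eq h hs
  have hin : β ∈ Icc (eta1 m n) (eta2 m n μ0) → ∀ s ∈ Icc (0 : ℝ) 1,
      |s ^ m + β * s ^ (m - n)| ≤ Kc m n * |β| ^ ((m : ℝ) / n) := fun h s hs =>
    abs_pow_add_le_of_nonpos hn0 hmn (h.2.trans heta2.le)
      (abs_one_add_le_Kc_mul hn0 hmn hμ0 hμ0eq h.2) le_rfl hs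
  refine ⟨fun _ hA => ?_, fun _ hB => ?_, fun hAB => ?_⟩
  · obtain ⟨hI, hK⟩ := hA
    dsimp only at hI hK
    rw [hnorm (Kc m n * |β| ^ ((m : ℝ) / n) + |γ|) (by linarith)
      (fun s hs => by linarith [hin hI s hs]) (Or.inr ?_), Kc_mul_abs_rpow hmn,
      show ((m : ℝ) - n) * (a * β) / (m * a) = ((m : ℝ) - n) / m * β by field_simp, abs_mul a γ]
    · ring
    · obtain ⟨s, hs, h⟩ := exists_abs_pow_add_eq_Kc_mul hn0 hmn hI.1 (hI.2.trans heta2.le)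
      exact ⟨s, hs, by rw [h]⟩
  · obtain ⟨hB, hF⟩ := hB
    simp only [calB, mem_ofPred_eq, add_comm β 1] at hB
    rw [hnorm 1 le_rfl (fun s hs => ?_) (Or.inl rfl), mul_one]
    by_cases hI : β ∈ Icc (eta1 m n) (eta2 m n μ0)
    · have h : ¬ 1 - Kc m n * |β| ^ ((m : ℝ) / n) < |γ| := fun h =>
        hF ⟨hI, h, by dsimp only; linarith⟩
      linarith [hin hI s hs]
    · linarith [hout hI s hs]
  · have hA : (β, γ) ∉ Aregion m n μ0 := fun h => hAB ⟨ha, Or.inl h⟩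
    have hB : (β, γ) ∉ Bregion m n μ0 := fun h => hAB ⟨ha, Or.inr h⟩
    have hF : (β, γ) ∉ Fregion m n μ0 := fun h => hA ⟨h.1, h.2.1.le⟩
    have hge : 1 ≤ |1 + β| + |γ| := by
      by_contra h
      exact hB ⟨by simpa [calB, add_comm β 1] using h, hF⟩
    have hI : β ∉ Icc (eta1 m n) (eta2 m n μ0) := fun hI => hA ⟨hI, by
      dsimp only
      linarith [abs_one_add_le_Kc_mul hn0 hmn hμ0 hμ0eq hI.2]⟩
    rw [hnorm (|1 + β| + |γ|) hge (fun s hs => by linarith [hout hI s hs])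
      (Or.inr ⟨1, by simp, by simp⟩), mul_add, ← abs_mul, ← abs_mul, mul_add, mul_one]
end

section
/- Let $m,n$ be even positive integers with $m>n$. Set $L_{m,n}=\tfrac{m}{m-n}(\tfrac{m-n}{n})^{n/m}$, $\lambda_0=-\tfrac{n}{m-n}$, and $R_{m,n}=2^{(m-n)/m}L_{m,n}$ (so $R_{m,m-n}=2^{n/m}L_{m,m-n}$). Then: (1) if $\tfrac{n}{m}\in(0,\tfrac13)$, the set of extreme points of $\mathsf{B}^h_{m,n}$ equals $\{\pm(-1,L_{m,n}(1-c)^{n/m},c):c\in[1+\lambda_0,1]\}\cup\{\pm(-1,R_{m,n}|c|^{n/m},c):c\in[-1,2\lambda_0]\}\cup\{\pm(a,L_{m,n}(1-a)^{(m-n)/m},-1):a\in[-1,1]\}\cup\{\pm(0,0,1),\pm(1,0,0),\pm(1,-1,1)\}$; (2) if $\tfrac{n}{m}\in[\tfrac13,\tfrac23]$, it equals $\{\pm(-1,L_{m,n}(1-c)^{n/m},c):c\in[1+\lambda_0,1]\}\cup\{\pm(a,L_{m,n}(1-a)^{(m-n)/m},-1):a\in[1+\tfrac{1}{\lambda_0},1]\}\cup\{\pm(0,0,1),\pm(1,0,0),\pm(1,-1,1),\pm(1,-3,1)\}$;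 (3) if $\tfrac{n}{m}\in(\tfrac23,1)$, it equals $\{\pm(-1,L_{m,n}(1-c)^{n/m},c):c\in[-1,1]\}\cup\{\pm(a,R_{m,m-n}|a|^{(m-n)/m},-1):a\in[-1,\tfrac{2}{\lambda_0}]\}\cup\{\pm(a,L_{m,n}(1-a)^{(m-n)/m},-1):a\in[1+\tfrac{1}{\lambda_0},1]\}\cup\{\pm(0,0,1),\pm(1,0,0),\pm(1,-1,1)\}$. -/
open Set

/-- The closed unit ball of the homogeneous trinomial norm. -/
noncomputable def homBall (m n : ℕ) : Set (ℝ × ℝ × ℝ) :=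
  {p | homNorm m n p.1 p.2.1 p.2.2 ≤ 1}

/-- The constant `L_{m,n} = m/(m-n) · ((m-n)/n)^{n/m}`. -/
noncomputable def Lc (m n : ℕ) : ℝ :=
  (m : ℝ) / ((m : ℝ) - n) * (((m : ℝ) - n) / n) ^ ((n : ℝ) / m)

/-- The constant `R_{m,n} = 2^{(m-n)/m} L_{m,n}`. -/
noncomputable def Rc (m n : ℕ) : ℝ :=
  (2 : ℝ) ^ (((m : ℝ) - n) / m) * Lc m n

/-- `λ₀ = -n/(m-n)`. -/
noncomputable def lam0 (m n : ℕ) : ℝ := -((n : ℝ) / ((m : ℝ) - n))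

/-- The optimal constant `1 / (p ^ p * q ^ q)` in `K * X ^ q * Y ^ p ≤ X + Y`, for `p + q = 1`. -/
noncomputable def amgmConst (p q : ℝ) : ℝ := (p ^ p * q ^ q)⁻¹

lemma amgmConst_comm (p q : ℝ) : amgmConst p q = amgmConst q p := by
  unfold amgmConst; rw [mul_comm]

lemma amgmConst_mul {p q X Y : ℝ} (hp : 0 < p) (hq : 0 < q) (hX : 0 ≤ X) (hY : 0 ≤ Y) :
    amgmConst p q * (X ^ q * Y ^ p) = (X / q) ^ q * (Y / p) ^ p := by
  rw [Real.div_rpow hX hq.le, Real.div_rpow hY hp.le]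
  unfold amgmConst
  have := Real.rpow_pos_of_pos hp p
  have := Real.rpow_pos_of_pos hq q
  field_simp

lemma amgmConst_mul_le {p q X Y : ℝ} (hp : 0 < p) (hq : 0 < q) (hpq : p + q = 1)
    (hX : 0 ≤ X) (hY : 0 ≤ Y) : amgmConst p q * (X ^ q * Y ^ p) ≤ X + Y := by
  rw [amgmConst_mul hp hq hX hY]
  have h := Real.geom_mean_le_arith_mean2_weighted hq.le hp.le (div_nonneg hX hq.le)
    (div_nonneg hY hp.le) (by linarith)
  rwa [mul_div_cancel₀ _ hq.ne', mul_div_cancel₀ _ hp.ne'] at h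

lemma proportional_of_amgmConst_mul_eq {p q X Y : ℝ} (hp : 0 < p) (hq : 0 < q) (hpq : p + q = 1)
    (hX : 0 ≤ X) (hY : 0 ≤ Y) (h : amgmConst p q * (X ^ q * Y ^ p) = X + Y) :
    p * X = q * Y := by
  rw [amgmConst_mul hp hq hX hY] at h
  have h2 := (Real.geom_mean_eq_arith_mean_weighted_iff_of_pos (Finset.univ : Finset (Fin 2))
    ![q, p] ![X / q, Y / p]
    (by intro i _; fin_cases i <;> simpa) (by simp; linarith)
    (by intro i _; fin_cases i <;> simp <;> positivity)).1 (by
      simp [Fin.prod_univ_two, Fin.sum_univ_two]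
      rw [h, mul_div_cancel₀ _ hq.ne', mul_div_cancel₀ _ hp.ne'])
  have h3 := h2 0 (Finset.mem_univ _) 1 (Finset.mem_univ _)
  simp at h3
  field_simp at h3
  linarith

lemma amgmConst_mul_proportional {p q r : ℝ} (hp : 0 < p) (hq : 0 < q) (hpq : p + q = 1)
    (hr : 0 ≤ r) : amgmConst p q * ((q * r) ^ q * (p * r) ^ p) = r := by
  rw [amgmConst_mul hp hq (by positivity) (by positivity), mul_div_cancel_left₀ _ hq.ne',
    mul_div_cancel_left₀ _ hp.ne', ← Real.rpow_add_of_nonneg hr hq.le hp.le, add_comm, hpq,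
    Real.rpow_one]

lemma mul_le_rpow_mul_rpow {p q u v : ℝ} (hp : 0 < p) (hq : 0 < q) (hpq : p + q = 1)
    (hu : u ∈ Icc (0 : ℝ) 1) (hv : v ∈ Icc (0 : ℝ) 1) : u * v ≤ u ^ q * v ^ p := by
  have h1 : u ≤ u ^ q := Real.self_le_rpow_of_le_one hu.1 hu.2 (by linarith)
  have h2 : v ≤ v ^ p := Real.self_le_rpow_of_le_one hv.1 hv.2 (by linarith)
  exact mul_le_mul h1 h2 hv.1 (Real.rpow_nonneg hu.1 _)

lemma rpow_mul_rpow_le {p q u v : ℝ} (hp : 0 < p) (hq : 0 < q) (hpq : p + q = 1)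
    (hu : 0 ≤ u) (hv : 0 ≤ v) : u ^ q * v ^ p ≤ q * u + p * v :=
  Real.geom_mean_le_arith_mean2_weighted hq.le hp.le hu hv (by linarith)

/-- The upper half `a u + b u ^ q v ^ p + c v ≤ 1` of the constraints defining the unit ball, in
the coordinates `u = x ^ m`, `v = y ^ m`, with `p = n / m` and `q = 1 - p`. -/
def UpperBound (p q a b c : ℝ) : Prop :=
  ∀ u ∈ Icc (0 : ℝ) 1, ∀ v ∈ Icc (0 : ℝ) 1, a * u + b * (u ^ q * v ^ p) + c * v ≤ 1

lemma UpperBound.swap {p q a b c : ℝ} (h : UpperBound p q a b c) : UpperBound q p c b a := by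
  intro u hu v hv
  have := h v hv u hu
  rw [mul_comm (u ^ p)]
  linarith

lemma UpperBound.mono {p q a b b' c : ℝ} (h : UpperBound p q a b c) (hb : b' ≤ b) :
    UpperBound p q a b' c := by
  intro u hu v hv
  have := h u hu v hv
  have h2 : 0 ≤ u ^ q * v ^ p := mul_nonneg (Real.rpow_nonneg hu.1 _) (Real.rpow_nonneg hv.1 _)
  nlinarith

lemma UpperBound.left_le {p q a b c : ℝ} (hp : 0 < p) (h : UpperBound p q a b c) : a ≤ 1 := by
  have := h 1 (by simp) 0 (by simp)
  simpa [Real.zero_rpow hp.ne'] using this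

lemma UpperBound.right_le {p q a b c : ℝ} (hq : 0 < q) (h : UpperBound p q a b c) : c ≤ 1 :=
  h.swap.left_le hq

lemma UpperBound.sum_le {p q a b c : ℝ} (h : UpperBound p q a b c) : b ≤ 1 - a - c := by
  have := h 1 (by simp) 1 (by simp)
  simp at this
  linarith

lemma upperBound_of_le_amgm {p q a b c : ℝ} (hp : 0 < p) (hq : 0 < q) (hpq : p + q = 1)
    (ha : a ≤ 0) (hc : c ≤ 1) (hb : b ≤ amgmConst p q * ((-a) ^ q * (1 - c) ^ p)) :
    UpperBound p q a b c := by
  intro u hu v hv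
  have h1 := amgmConst_mul_le hp hq hpq (mul_nonneg (neg_nonneg.2 ha) hu.1)
    (mul_nonneg (sub_nonneg.2 hc) hv.1)
  rw [Real.mul_rpow (neg_nonneg.2 ha) hu.1, Real.mul_rpow (sub_nonneg.2 hc) hv.1] at h1
  have h2 : 0 ≤ u ^ q * v ^ p := mul_nonneg (Real.rpow_nonneg hu.1 _) (Real.rpow_nonneg hv.1 _)
  have h3 := mul_le_mul_of_nonneg_right hb h2
  have := hv.2
  nlinarith

/-- The value of `b u ^ q` at the critical point of `u ↦ a u + b u ^ q + c` when `b` is extremal. -/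
lemma amgm_mul_critical {p q a c : ℝ} (hp : 0 < p) (hq : 0 < q) (hpq : p + q = 1)
    (ha : a < 0) (hc : c ≤ 1) :
    amgmConst p q * ((-a) ^ q * (1 - c) ^ p) * (q * (1 - c) / -(p * a)) ^ q = (1 - c) / p := by
  have hc' : 0 ≤ 1 - c := by linarith
  have hpa : 0 < -(p * a) := by nlinarith
  have h := amgmConst_mul_proportional hp hq hpq (r := (1 - c) / p) (by positivity)
  rw [mul_div_cancel₀ _ hp.ne'] at h
  have h2 : q * ((1 - c) / p) = -a * (q * (1 - c) / -(p * a)) := by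
    have : a ≠ 0 := ha.ne
    field_simp
  rw [h2, Real.mul_rpow (by linarith) (by positivity)] at h
  rw [← h]; ring

lemma le_zero_of_upperBound_right_one {p q a b : ℝ} (hp : 0 < p) (hpq : p + q = 1)
    (h : UpperBound p q a b 1) : b ≤ 0 := by
  by_contra! hb
  obtain ⟨u, hu0, hu1, hu⟩ : ∃ u : ℝ, 0 < u ∧ u ≤ 1 ∧ |a| * u ^ p < b := by
    have hlim : Filter.Tendsto (fun u : ℝ => |a| * u ^ p) (nhdsWithin 0 (Ioi 0)) (nhds 0) := by
      have : ContinuousAt (fun u : ℝ => |a| * u ^ p) 0 :=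
        continuousAt_const.mul (Real.continuousAt_rpow_const _ _ (Or.inr hp.le))
      have h2 := this.tendsto
      simp only [Real.zero_rpow hp.ne', mul_zero] at h2
      exact h2.mono_left nhdsWithin_le_nhds
    have h1 := hlim.eventually (gt_mem_nhds hb)
    have h2 : ∀ᶠ u : ℝ in nhdsWithin 0 (Ioi 0), u ∈ Ioo (0 : ℝ) 1 :=
      Ioo_mem_nhdsGT one_pos
    obtain ⟨u, h3, h4⟩ := (h1.and h2).exists
    exact ⟨u, h4.1, h4.2.le, h3⟩
  have h1 := h u ⟨hu0.le, hu1⟩ 1 (by simp)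
  simp only [Real.one_rpow, mul_one] at h1
  have h2 : u = u ^ p * u ^ q := by
    rw [← Real.rpow_add hu0, hpq, Real.rpow_one]
  have h3 : 0 < u ^ q := Real.rpow_pos_of_pos hu0 _
  have h4 : -|a| * u ≤ a * u := mul_le_mul_of_nonneg_right (neg_abs_le a) hu0.le
  have h5 : |a| * u ^ p * u ^ q < b * u ^ q := mul_lt_mul_of_pos_right hu h3
  have h6 : |a| * u = |a| * u ^ p * u ^ q := by rw [mul_assoc, ← h2]
  linarith

lemma le_amgm_of_upperBound {p q a b c : ℝ} (hp : 0 < p) (hq : 0 < q) (hpq : p + q = 1)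
    (hac : q * (1 - c) ≤ -(p * a)) (h : UpperBound p q a b c) :
    b ≤ amgmConst p q * ((-a) ^ q * (1 - c) ^ p) := by
  have hc := h.right_le hq
  rcases hc.eq_or_lt with rfl | hc
  · simpa [Real.zero_rpow hp.ne'] using le_zero_of_upperBound_right_one hp hpq h
  have hqc : 0 < q * (1 - c) := mul_pos hq (by linarith)
  have hpa : 0 < -(p * a) := by linarith
  have ha : a < 0 := by nlinarith
  have hcrit := amgm_mul_critical hp hq hpq ha hc.le
  set u := q * (1 - c) / -(p * a) with hu
  have hu0 : 0 < u := by positivity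
  have h1 := h u ⟨hu0.le, (div_le_one hpa).2 hac⟩ 1 (by simp)
  simp only [Real.one_rpow, mul_one] at h1
  have h2 : 0 < u ^ q := Real.rpow_pos_of_pos hu0 _
  refine le_of_mul_le_mul_right ?_ h2
  rw [hcrit]
  have h3 : a * u = -(q * (1 - c) / p) := by
    rw [hu]; have := ha.ne; field_simp
  have h4 : (1 - c) / p = (1 - c) + q * (1 - c) / p := by
    field_simp; rw [hpq]
  linarith

lemma upperBound_of_le_linear {p q a b c : ℝ} (hp : 0 < p) (hq : 0 < q) (hpq : p + q = 1)
    (ha : a ≤ 1) (hc : c ≤ 1) (h1 : -(p * a) ≤ q * (1 - c)) (h2 : -(q * c) ≤ p * (1 - a))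
    (hb : b ≤ 1 - a - c) : UpperBound p q a b c := by
  refine UpperBound.mono ?_ hb
  intro u hu v hv
  have hw1 := mul_le_rpow_mul_rpow hp hq hpq hu hv
  have hw2 := rpow_mul_rpow_le hp hq hpq hu.1 hv.1
  obtain ⟨hu0, hu1⟩ := hu
  obtain ⟨hv0, hv1⟩ := hv
  rcases le_total 0 (1 - a - c) with h | h
  · have h3 := mul_le_mul_of_nonneg_left hw2 h
    have h4 : 0 ≤ (1 - u) * (p * a + q * (1 - c)) :=
      mul_nonneg (by linarith) (by linarith)
    have h5 : 0 ≤ (1 - v) * (q * c + p * (1 - a)) :=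
      mul_nonneg (by linarith) (by linarith)
    obtain rfl : q = 1 - p := by linarith
    nlinarith
  · have h3 := mul_le_mul_of_nonpos_left hw1 h
    nlinarith [mul_nonneg (mul_nonneg (sub_nonneg.2 ha) hu0) (sub_nonneg.2 hv1),
      mul_nonneg (mul_nonneg (sub_nonneg.2 hc) hv0) (sub_nonneg.2 hu1),
      mul_nonneg (sub_nonneg.2 hv1) (sub_nonneg.2 hu1)]

/-- The largest `b` with `UpperBound p q a b c`, for `a, c ≤ 1`. -/
noncomputable def upperEnvelope (p q a c : ℝ) : ℝ :=
  if q * (1 - c) ≤ -(p * a) then amgmConst p q * ((-a) ^ q * (1 - c) ^ p)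
  else if p * (1 - a) ≤ -(q * c) then amgmConst q p * ((-c) ^ p * (1 - a) ^ q)
  else 1 - a - c

lemma upperBound_iff {p q a b c : ℝ} (hp : 0 < p) (hq : 0 < q) (hpq : p + q = 1)
    (ha : a ≤ 1) (hc : c ≤ 1) : UpperBound p q a b c ↔ b ≤ upperEnvelope p q a c := by
  have hqp : q + p = 1 := by linarith
  unfold upperEnvelope
  split_ifs with h1 h2
  · exact ⟨le_amgm_of_upperBound hp hq hpq h1,
      upperBound_of_le_amgm hp hq hpq (by nlinarith) hc⟩
  · exact ⟨fun h => le_amgm_of_upperBound hq hp hqp h2 h.swap,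
      fun h => (upperBound_of_le_amgm hq hp hqp (by nlinarith) ha h).swap⟩
  · exact ⟨fun h => h.sum_le,
      upperBound_of_le_linear hp hq hpq ha hc (not_le.1 h1).le (not_le.1 h2).le⟩

/-- The unit ball in the coordinates `u = x ^ m`, `v = y ^ m`. -/
def planarBall (p q : ℝ) : Set (ℝ × ℝ × ℝ) :=
  {x | UpperBound p q x.1 x.2.1 x.2.2 ∧ UpperBound p q (-x.1) (-x.2.1) (-x.2.2)}

lemma mk_mem_planarBall {p q a b c : ℝ} : (a, b, c) ∈ planarBall p q ↔
    UpperBound p q a b c ∧ UpperBound p q (-a) (-b) (-c) := Iff.rfl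

lemma neg_mem_planarBall {p q : ℝ} {x : ℝ × ℝ × ℝ} (hx : x ∈ planarBall p q) :
    -x ∈ planarBall p q := by
  obtain ⟨a, b, c⟩ := x
  rw [mk_mem_planarBall] at hx
  simp only [Prod.neg_mk, mk_mem_planarBall, neg_neg]
  exact hx.symm

lemma left_mem_Icc {p q a b c : ℝ} (hp : 0 < p) (h : (a, b, c) ∈ planarBall p q) :
    a ∈ Icc (-1 : ℝ) 1 :=
  ⟨by linarith [h.2.left_le hp], h.1.left_le hp⟩

lemma right_mem_Icc {p q a b c : ℝ} (hq : 0 < q) (h : (a, b, c) ∈ planarBall p q) :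
    c ∈ Icc (-1 : ℝ) 1 :=
  ⟨by linarith [h.2.right_le hq], h.1.right_le hq⟩

lemma mem_planarBall_of_nonneg {p q a c : ℝ} (hp : 0 < p) (hq : 0 < q) (hpq : p + q = 1)
    (ha0 : 0 ≤ a) (ha1 : a ≤ 1) (hc0 : 0 ≤ c) (hc1 : c ≤ 1) :
    (a, -(a * c), c) ∈ planarBall p q := by
  have hac : 0 ≤ a * c := mul_nonneg ha0 hc0
  refine ⟨fun u hu v hv => ?_, fun u hu v hv => ?_⟩
  · have hw := mul_le_mul_of_nonneg_left (mul_le_rpow_mul_rpow hp hq hpq hu hv) hac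
    have h1 : a * u ≤ 1 := mul_le_one₀ ha1 hu.1 hu.2
    have h2 : c * v ≤ 1 := mul_le_one₀ hc1 hv.1 hv.2
    simp only
    nlinarith [mul_nonneg (sub_nonneg.2 h1) (sub_nonneg.2 h2)]
  · have hw := mul_le_mul_of_nonneg_left (rpow_mul_rpow_le hp hq hpq hu.1 hv.1) hac
    have h1 : 0 ≤ a * u := mul_nonneg ha0 hu.1
    have h2 : 0 ≤ c * v := mul_nonneg hc0 hv.1
    have h3 : c * q ≤ 1 := mul_le_one₀ hc1 hq.le (by linarith)
    have h4 : a * p ≤ 1 := mul_le_one₀ ha1 hp.le (by linarith)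
    have h5 := mul_le_mul_of_nonneg_left h3 h1
    have h6 := mul_le_mul_of_nonneg_left h4 h2
    simp only
    linarith

lemma mem_planarBall_zero {p q a c : ℝ} (ha : a ∈ Icc (-1 : ℝ) 1) (hc : c ∈ Icc (-1 : ℝ) 1)
    (hac : a * c ≤ 0) : (a, 0, c) ∈ planarBall p q := by
  obtain ⟨ha0, ha1⟩ := ha
  obtain ⟨hc0, hc1⟩ := hc
  have key : ∀ a c : ℝ, -1 ≤ a → a ≤ 1 → -1 ≤ c → c ≤ 1 → a * c ≤ 0 → UpperBound p q a 0 c := by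
    rintro a c ha0 ha1 hc0 hc1 hac u ⟨hu0, hu1⟩ v ⟨hv0, hv1⟩
    have h1 : a * u ≤ 1 := mul_le_one₀ ha1 hu0 hu1
    have h2 : c * v ≤ 1 := mul_le_one₀ hc1 hv0 hv1
    rcases mul_nonpos_iff.1 hac with ⟨_, h⟩ | ⟨h, _⟩
    · linarith [mul_nonpos_of_nonpos_of_nonneg h hv0]
    · linarith [mul_nonpos_of_nonpos_of_nonneg h hu0]
  refine ⟨key a c ha0 ha1 hc0 hc1 hac, ?_⟩
  simp only [neg_zero]
  exact key (-a) (-c) (by linarith) (by linarith) (by linarith) (by linarith) (by linarith)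

lemma exists_mem_planarBall {p q a c : ℝ} (hp : 0 < p) (hq : 0 < q) (hpq : p + q = 1)
    (ha : a ∈ Icc (-1 : ℝ) 1) (hc : c ∈ Icc (-1 : ℝ) 1) : ∃ b, (a, b, c) ∈ planarBall p q := by
  rcases le_total (a * c) 0 with h | h
  · exact ⟨0, mem_planarBall_zero ha hc h⟩
  rcases mul_nonneg_iff.1 h with ⟨h1, h2⟩ | ⟨h1, h2⟩
  · exact ⟨_, mem_planarBall_of_nonneg hp hq hpq h1 ha.2 h2 hc.2⟩
  · have := neg_mem_planarBall (mem_planarBall_of_nonneg (a := -a) (c := -c) hp hq hpq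
      (by linarith) (by linarith [ha.1]) (by linarith) (by linarith [hc.1]))
    simp only [Prod.neg_mk, neg_neg] at this
    exact ⟨_, this⟩

lemma mem_planarBall_iff {p q a b c : ℝ} (hp : 0 < p) (hq : 0 < q) (hpq : p + q = 1)
    (ha : a ∈ Icc (-1 : ℝ) 1) (hc : c ∈ Icc (-1 : ℝ) 1) : (a, b, c) ∈ planarBall p q ↔
      b ≤ upperEnvelope p q a c ∧ -b ≤ upperEnvelope p q (-a) (-c) := by
  rw [mk_mem_planarBall, upperBound_iff hp hq hpq ha.2 hc.2,
    upperBound_iff hp hq hpq (by linarith [ha.1]) (by linarith [hc.1])]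

lemma mem_planarBall_of_forall_le {p q a b c : ℝ} (hp : 0 < p) (hq : 0 < q) (hpq : p + q = 1)
    (ha : a ∈ Icc (-1 : ℝ) 1) (hc : c ∈ Icc (-1 : ℝ) 1) (hb : UpperBound p q a b c)
    (hmax : ∀ b', UpperBound p q a b' c → b' ≤ b) : (a, b, c) ∈ planarBall p q := by
  obtain ⟨b', hb'⟩ := exists_mem_planarBall hp hq hpq ha hc
  exact ⟨hb, hb'.2.mono (neg_le_neg (hmax b' hb'.1))⟩

lemma amgm_mem_planarBall {p q a c : ℝ} (hp : 0 < p) (hq : 0 < q) (hpq : p + q = 1)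
    (ha : -1 ≤ a) (hc : c ∈ Icc (-1 : ℝ) 1) (hac : q * (1 - c) ≤ -(p * a)) :
    (a, amgmConst p q * ((-a) ^ q * (1 - c) ^ p), c) ∈ planarBall p q := by
  have ha0 : a ≤ 0 := by nlinarith [hc.2]
  exact mem_planarBall_of_forall_le hp hq hpq ⟨ha, by linarith⟩ hc
    (upperBound_of_le_amgm hp hq hpq ha0 hc.2 le_rfl) fun b' => le_amgm_of_upperBound hp hq hpq hac

lemma linear_mem_planarBall {p q a c : ℝ} (hp : 0 < p) (hq : 0 < q) (hpq : p + q = 1)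
    (ha : a ∈ Icc (-1 : ℝ) 1) (hc : c ∈ Icc (-1 : ℝ) 1) (h1 : -(p * a) ≤ q * (1 - c))
    (h2 : -(q * c) ≤ p * (1 - a)) : (a, 1 - a - c, c) ∈ planarBall p q :=
  mem_planarBall_of_forall_le hp hq hpq ha hc
    (upperBound_of_le_linear hp hq hpq ha.2 hc.2 h1 h2 le_rfl) fun _ h => h.sum_le

lemma mem_extremePoints_planarBall_iff {p q a b c : ℝ} :
    (a, b, c) ∈ extremePoints ℝ (planarBall p q) ↔ (a, b, c) ∈ planarBall p q ∧
      ∀ a₁ b₁ c₁ a₂ b₂ c₂ s t : ℝ, 0 < s → 0 < t → s + t = 1 →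
        (a₁, b₁, c₁) ∈ planarBall p q → (a₂, b₂, c₂) ∈ planarBall p q →
        s * a₁ + t * a₂ = a → s * b₁ + t * b₂ = b → s * c₁ + t * c₂ = c →
        a₁ = a ∧ b₁ = b ∧ c₁ = c := by
  rw [mem_extremePoints_iff_left]
  refine and_congr_right fun _ => ⟨fun h a₁ b₁ c₁ a₂ b₂ c₂ s t hs ht hst h1 h2 ha hb hc => ?_,
    fun h => ?_⟩
  · have := h _ h1 _ h2 ⟨s, t, hs, ht, hst, by simp [ha, hb, hc]⟩
    simpa using this
  · rintro ⟨a₁, b₁, c₁⟩ h1 ⟨a₂, b₂, c₂⟩ h2 ⟨s, t, hs, ht, hst, hx⟩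
    simp only [Prod.smul_mk, smul_eq_mul, Prod.mk_add_mk, Prod.mk.injEq] at hx
    simpa using h a₁ b₁ c₁ a₂ b₂ c₂ s t hs ht hst h1 h2 hx.1 hx.2.1 hx.2.2

lemma swap_mem_planarBall {p q a b c : ℝ} (h : (a, b, c) ∈ planarBall p q) :
    (c, b, a) ∈ planarBall q p := ⟨h.1.swap, h.2.swap⟩

lemma swap_mem_extremePoints {p q a b c : ℝ} (h : (a, b, c) ∈ extremePoints ℝ (planarBall p q)) :
    (c, b, a) ∈ extremePoints ℝ (planarBall q p) := by
  rw [mem_extremePoints_planarBall_iff] at h ⊢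
  refine ⟨swap_mem_planarBall h.1, fun a₁ b₁ c₁ a₂ b₂ c₂ s t hs ht hst h1 h2 ha hb hc => ?_⟩
  obtain ⟨h3, h4, h5⟩ := h.2 c₁ b₁ a₁ c₂ b₂ a₂ s t hs ht hst (swap_mem_planarBall h1)
    (swap_mem_planarBall h2) hc hb ha
  exact ⟨h5, h4, h3⟩

lemma neg_mem_extremePoints {p q a b c : ℝ} (h : (a, b, c) ∈ extremePoints ℝ (planarBall p q)) :
    (-a, -b, -c) ∈ extremePoints ℝ (planarBall p q) := by
  rw [mem_extremePoints_planarBall_iff] at h ⊢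
  refine ⟨neg_mem_planarBall h.1, fun a₁ b₁ c₁ a₂ b₂ c₂ s t hs ht hst h1 h2 ha hb hc => ?_⟩
  obtain ⟨h3, h4, h5⟩ := h.2 _ _ _ _ _ _ s t hs ht hst (neg_mem_planarBall h1)
    (neg_mem_planarBall h2) (by simp only; linarith) (by simp only; linarith)
    (by simp only; linarith)
  simp only at h3 h4 h5
  exact ⟨by linarith, by linarith, by linarith⟩

lemma eq_of_convex_combination_eq_max {s t x y M : ℝ} (hs : 0 < s) (ht : 0 < t) (hst : s + t = 1)
    (hx : x ≤ M) (hy : y ≤ M) (h : s * x + t * y = M) : x = M ∧ y = M := by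
  obtain rfl : t = 1 - s := by linarith
  have h1 : 0 ≤ s * (M - x) := mul_nonneg hs.le (by linarith)
  have h2 : 0 ≤ (1 - s) * (M - y) := mul_nonneg ht.le (by linarith)
  constructor <;> nlinarith

/-- The points of the curved part of the upper boundary lying over the edges `a = -1`, `c = -1`. -/
def AmgmExtreme (p q a b c : ℝ) : Prop :=
  -1 ≤ a ∧ c ∈ Icc (-1 : ℝ) 1 ∧ (a = -1 ∨ c = -1) ∧ q * (1 - c) ≤ -(p * a) ∧
    b = amgmConst p q * ((-a) ^ q * (1 - c) ^ p)

/-- A point of the unit ball on the line through an `AmgmExtreme` point contained in the supporting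
plane and in the edge is that point. -/
lemma eq_of_active {p q a c a₁ b₁ c₁ : ℝ} (hp : 0 < p) (hq : 0 < q) (hpq : p + q = 1)
    (ha : a < 0) (hc : c < 1) (h₁ : UpperBound p q a₁ b₁ c₁) (hedge : a₁ = a ∨ c₁ = c)
    (hac : q * (1 - c₁) ≤ -(p * a₁))
    (hact : a₁ * (q * (1 - c) / -(p * a)) + b₁ * (q * (1 - c) / -(p * a)) ^ q + c₁ = 1) :
    a₁ = a ∧ c₁ = c := by
  have hpa : 0 < -(p * a) := by nlinarith
  have hqc : 0 < q * (1 - c) := mul_pos hq (by linarith)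
  have hc₁ := h₁.right_le hq
  have ha₁ : a₁ ≤ 0 := by nlinarith
  set u := q * (1 - c) / -(p * a) with hu
  have hu0 : 0 < u := by positivity
  have h2 : 0 < u ^ q := Real.rpow_pos_of_pos hu0 _
  have hle := mul_le_mul_of_nonneg_right (le_amgm_of_upperBound hp hq hpq hac h₁) h2.le
  have hXn : 0 ≤ -a₁ * u := mul_nonneg (by linarith) hu0.le
  have hle2 := amgmConst_mul_le hp hq hpq hXn (sub_nonneg.2 hc₁)
  have heq : amgmConst p q * ((-a₁ * u) ^ q * (1 - c₁) ^ p) = -a₁ * u + (1 - c₁) := by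
    refine le_antisymm hle2 ?_
    rw [Real.mul_rpow (by linarith) hu0.le]
    nlinarith
  have hprop := proportional_of_amgmConst_mul_eq hp hq hpq hXn (sub_nonneg.2 hc₁) heq
  have hua : p * (-a * u) = q * (1 - c) := by
    rw [hu]; have := ha.ne; field_simp
  rcases hedge with rfl | rfl
  · refine ⟨rfl, ?_⟩
    have := mul_left_cancel₀ hq.ne' (hprop.symm.trans hua)
    linarith
  · refine ⟨?_, rfl⟩
    have := mul_right_cancel₀ hu0.ne' (mul_left_cancel₀ hp.ne' (hprop.trans hua.symm))
    linarith

lemma corner_mem_extremePoints {p q : ℝ} (hp : 0 < p) (hq : 0 < q) (hpq : p + q = 1) {a c b : ℝ}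
    (ha : a = 1 ∨ a = -1) (hc : c = 1 ∨ c = -1) (hb : UpperBound p q a b c)
    (hmax : ∀ b', UpperBound p q a b' c → b' ≤ b) :
    (a, b, c) ∈ extremePoints ℝ (planarBall p q) := by
  have ha' : a ∈ Icc (-1 : ℝ) 1 := by rcases ha with rfl | rfl <;> norm_num
  have hc' : c ∈ Icc (-1 : ℝ) 1 := by rcases hc with rfl | rfl <;> norm_num
  rw [mem_extremePoints_planarBall_iff]
  refine ⟨mem_planarBall_of_forall_le hp hq hpq ha' hc' hb hmax,
    fun a₁ b₁ c₁ a₂ b₂ c₂ s t hs ht hst h1 h2 hea heb hec => ?_⟩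
  have hcorner : ∀ {x y z : ℝ}, (z = 1 ∨ z = -1) → x ∈ Icc (-1 : ℝ) 1 → y ∈ Icc (-1 : ℝ) 1 →
      s * x + t * y = z → x = z ∧ y = z := by
    rintro x y z (rfl | rfl) hx hy h
    · exact eq_of_convex_combination_eq_max hs ht hst hx.2 hy.2 h
    · have := eq_of_convex_combination_eq_max (x := -x) (y := -y) (M := 1) hs ht hst
        (by linarith [hx.1]) (by linarith [hy.1]) (by linarith)
      exact ⟨by linarith, by linarith⟩
  obtain ⟨rfl, rfl⟩ := hcorner ha (left_mem_Icc hp h1) (left_mem_Icc hp h2) hea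
  obtain ⟨rfl, rfl⟩ := hcorner hc (right_mem_Icc hq h1) (right_mem_Icc hq h2) hec
  exact ⟨rfl, (eq_of_convex_combination_eq_max hs ht hst (hmax _ h1.1) (hmax _ h2.1) heb).1, rfl⟩

lemma AmgmExtreme.mem_extremePoints {p q a b c : ℝ} (hp : 0 < p) (hq : 0 < q) (hpq : p + q = 1)
    (h : AmgmExtreme p q a b c) : (a, b, c) ∈ extremePoints ℝ (planarBall p q) := by
  obtain ⟨ha, hc, hedge, hac, rfl⟩ := h
  rcases hc.2.eq_or_lt with hc1 | hc1
  · have ha1 : a = -1 := by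
      rcases hedge with h | h
      · exact h
      · linarith
    exact corner_mem_extremePoints hp hq hpq (Or.inr ha1) (Or.inl hc1)
      (upperBound_of_le_amgm hp hq hpq (by linarith) hc.2 le_rfl)
      fun b' => le_amgm_of_upperBound hp hq hpq hac
  have hqc : 0 < q * (1 - c) := mul_pos hq (by linarith)
  have hpa : 0 < -(p * a) := by linarith
  have ha0 : a < 0 := by nlinarith
  rw [mem_extremePoints_planarBall_iff]
  refine ⟨amgm_mem_planarBall hp hq hpq ha hc hac,
    fun a₁ b₁ c₁ a₂ b₂ c₂ s t hs ht hst h1 h2 hea heb hec => ?_⟩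
  have hcrit := amgm_mul_critical hp hq hpq ha0 hc.2
  have hact := fun a₁ b₁ c₁ =>
    eq_of_active (a₁ := a₁) (b₁ := b₁) (c₁ := c₁) hp hq hpq ha0 hc1
  have hua : a * (q * (1 - c) / -(p * a)) = -(q * (1 - c) / p) := by
    have := ha0.ne; field_simp
  set u := q * (1 - c) / -(p * a) with hu
  have hu0 : 0 < u := by positivity
  have hu1 : u ≤ 1 := (div_le_one hpa).2 hac
  have hq0 : 0 < u ^ q := Real.rpow_pos_of_pos hu0 _
  set b := amgmConst p q * ((-a) ^ q * (1 - c) ^ p) with hb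
  have hx : a * u + b * u ^ q + c = 1 := by
    rw [hcrit, hua]
    have : (1 - c) / p = (1 - c) + q * (1 - c) / p := by
      field_simp; rw [hpq]
    linarith
  have hl1 := h1.1 u ⟨hu0.le, hu1⟩ 1 (by simp)
  have hl2 := h2.1 u ⟨hu0.le, hu1⟩ 1 (by simp)
  simp only [Real.one_rpow, mul_one] at hl1 hl2
  obtain ⟨he1, he2⟩ := eq_of_convex_combination_eq_max hs ht hst hl1 hl2 (by
    rw [← hx, ← hea, ← heb, ← hec]; ring)
  have ha₁ := left_mem_Icc hp h1
  have ha₂ := left_mem_Icc hp h2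
  have hc₁ := right_mem_Icc hq h1
  have hc₂ := right_mem_Icc hq h2
  have hfin : a₁ = a ∧ c₁ = c → a₁ = a ∧ b₁ = b ∧ c₁ = c := by
    rintro ⟨rfl, rfl⟩
    exact ⟨rfl, mul_right_cancel₀ hq0.ne' (by linarith), rfl⟩
  have hsum : s * (p * a₁ + q * (1 - c₁)) + t * (p * a₂ + q * (1 - c₂)) =
      p * a + q * (1 - c) := by
    rw [← hea, ← hec]
    linear_combination q * hst
  have hedge' : (a₁ = a ∧ a₂ = a) ∨ (c₁ = c ∧ c₂ = c) := by
    rcases hedge with h | h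
    · left
      have := eq_of_convex_combination_eq_max (x := -a₁) (y := -a₂) (M := 1) hs ht hst
        (by linarith [ha₁.1]) (by linarith [ha₂.1]) (by linarith)
      exact ⟨by linarith, by linarith⟩
    · right
      have := eq_of_convex_combination_eq_max (x := -c₁) (y := -c₂) (M := 1) hs ht hst
        (by linarith [hc₁.1]) (by linarith [hc₂.1]) (by linarith)
      exact ⟨by linarith, by linarith⟩
  rcases le_or_gt (q * (1 - c₁)) (-(p * a₁)) with h | h
  · exact hfin (hact _ _ _ h1.1 (hedge'.imp And.left And.left) h he1)
  · have h' : q * (1 - c₂) ≤ -(p * a₂) := by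
      have h3 := mul_pos hs (show 0 < p * a₁ + q * (1 - c₁) by linarith)
      have h4 : t * (p * a₂ + q * (1 - c₂)) < 0 := by linarith
      have := neg_of_mul_neg_right h4 ht.le
      linarith
    obtain ⟨rfl, rfl⟩ := hact _ _ _ h2.1 (hedge'.imp And.right And.right) h' he2
    refine hfin ⟨mul_left_cancel₀ hs.ne' ?_, mul_left_cancel₀ hs.ne' ?_⟩
    · linear_combination hea - a₂ * hst
    · linear_combination hec - c₂ * hst

lemma apex_mem_extremePoints {p q : ℝ} (hp : 0 < p) (hq : 0 < q) (hpq : p + q = 1) :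
    ((0 : ℝ), (0 : ℝ), (1 : ℝ)) ∈ extremePoints ℝ (planarBall p q) := by
  rw [mem_extremePoints_planarBall_iff]
  refine ⟨mem_planarBall_zero (by norm_num) (by norm_num) (by norm_num),
    fun a₁ b₁ c₁ a₂ b₂ c₂ s t hs ht hst h1 h2 hea heb hec => ?_⟩
  obtain ⟨rfl, rfl⟩ := eq_of_convex_combination_eq_max hs ht hst (right_mem_Icc hq h1).2
    (right_mem_Icc hq h2).2 hec
  obtain ⟨rfl, rfl⟩ := eq_of_convex_combination_eq_max hs ht hst
    (le_zero_of_upperBound_right_one hp hpq h1.1)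
    (le_zero_of_upperBound_right_one hp hpq h2.1) heb
  exact ⟨(eq_of_convex_combination_eq_max hs ht hst (by linarith [h1.1.sum_le])
    (by linarith [h2.1.sum_le]) hea).1, rfl, rfl⟩

/-- The extreme points of `planarBall p q` on the upper part of its boundary. -/
def UpperExtreme (p q a b c : ℝ) : Prop :=
  AmgmExtreme p q a b c ∨ AmgmExtreme q p c b a ∨ (a = 0 ∧ b = 0 ∧ c = 1) ∨
    (a = 1 ∧ b = 0 ∧ c = 0) ∨ (a = 1 ∧ b = -1 ∧ c = 1) ∨
    (a = -1 ∧ b = 3 ∧ c = -1 ∧ p ≤ 2 * q ∧ q ≤ 2 * p)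

lemma UpperExtreme.mem_extremePoints {p q a b c : ℝ} (hp : 0 < p) (hq : 0 < q) (hpq : p + q = 1)
    (h : UpperExtreme p q a b c) : (a, b, c) ∈ extremePoints ℝ (planarBall p q) := by
  have hqp : q + p = 1 := by linarith
  rcases h with h | h | ⟨rfl, rfl, rfl⟩ | ⟨rfl, rfl, rfl⟩ | ⟨rfl, rfl, rfl⟩ | ⟨rfl, rfl, rfl, h1, h2⟩
  · exact h.mem_extremePoints hp hq hpq
  · exact swap_mem_extremePoints (h.mem_extremePoints hq hp hqp)
  · exact apex_mem_extremePoints hp hq hpq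
  · exact swap_mem_extremePoints (apex_mem_extremePoints hq hp hqp)
  · exact corner_mem_extremePoints hp hq hpq (Or.inl rfl) (Or.inl rfl)
      (upperBound_of_le_linear hp hq hpq le_rfl le_rfl (by linarith) (by linarith) (by norm_num))
      fun _ h => h.sum_le.trans (by norm_num)
  · exact corner_mem_extremePoints hp hq hpq (Or.inr rfl) (Or.inr rfl)
      (upperBound_of_le_linear hp hq hpq (by norm_num) (by norm_num) (by linarith) (by linarith)
        (by norm_num))
      fun _ h => h.sum_le.trans (by norm_num)

lemma not_extreme_of_add_sub_mem {p q a b c α β γ : ℝ}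
    (h : (a, b, c) ∈ extremePoints ℝ (planarBall p q))
    (h1 : (a + α, b + β, c + γ) ∈ planarBall p q) (h2 : (a - α, b - β, c - γ) ∈ planarBall p q) :
    α = 0 ∧ β = 0 ∧ γ = 0 := by
  rw [mem_extremePoints_planarBall_iff] at h
  obtain ⟨h3, h4, h5⟩ := h.2 _ _ _ _ _ _ (1 / 2) (1 / 2) (by norm_num) (by norm_num) (by norm_num)
    h1 h2 (by ring) (by ring) (by ring)
  exact ⟨by linarith, by linarith, by linarith⟩

lemma amgmExtreme_or_apex {p q a c : ℝ} (hp : 0 < p) (hq : 0 < q) (hpq : p + q = 1)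
    (ha : a ∈ Icc (-1 : ℝ) 1) (hc : c ∈ Icc (-1 : ℝ) 1) (hac : q * (1 - c) ≤ -(p * a))
    (h : (a, amgmConst p q * ((-a) ^ q * (1 - c) ^ p), c) ∈ extremePoints ℝ (planarBall p q)) :
    AmgmExtreme p q a (amgmConst p q * ((-a) ^ q * (1 - c) ^ p)) c ∨ (a = 0 ∧ c = 1) := by
  by_cases hedge : a = -1 ∨ c = -1
  · exact Or.inl ⟨ha.1, hc, hedge, hac, rfl⟩
  push Not at hedge
  right
  have ha1 : -1 < a := lt_of_le_of_ne ha.1 (Ne.symm hedge.1)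
  have hc1 : -1 < c := lt_of_le_of_ne hc.1 (Ne.symm hedge.2)
  have hc0 : 0 ≤ 1 - c := by linarith [hc.2]
  have ha0 : 0 ≤ -a := by nlinarith
  obtain ⟨δ, hδ, hδa, hδc⟩ : ∃ δ : ℝ, 0 < δ ∧ δ ≤ 1 + a ∧ δ ≤ (1 + c) / 2 :=
    ⟨min (1 + a) ((1 + c) / 2), lt_min (by linarith) (by linarith), min_le_left _ _,
      min_le_right _ _⟩
  have hcone : (1 + δ) * (amgmConst p q * ((-a) ^ q * (1 - c) ^ p)) =
      amgmConst p q * ((-((1 + δ) * a)) ^ q * (1 - (1 + (1 + δ) * (c - 1))) ^ p) := by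
    have h1 : -((1 + δ) * a) = (1 + δ) * -a := by ring
    have h2 : 1 - (1 + (1 + δ) * (c - 1)) = (1 + δ) * (1 - c) := by ring
    have h3 : (1 + δ) ^ q * (1 + δ) ^ p = 1 + δ := by
      rw [← Real.rpow_add (by linarith), add_comm q, hpq, Real.rpow_one]
    rw [h1, h2, Real.mul_rpow (by linarith) ha0, Real.mul_rpow (by linarith) hc0]
    linear_combination -(amgmConst p q * ((-a) ^ q * (1 - c) ^ p)) * h3
  have hmem : ((1 + δ) * a, (1 + δ) * (amgmConst p q * ((-a) ^ q * (1 - c) ^ p)),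
      1 + (1 + δ) * (c - 1)) ∈ planarBall p q := by
    rw [hcone]
    refine amgm_mem_planarBall hp hq hpq (by nlinarith) ⟨by nlinarith, by nlinarith⟩ ?_
    nlinarith
  have hapex : ((0 : ℝ), (0 : ℝ), (1 : ℝ)) ∈ planarBall p q :=
    (apex_mem_extremePoints hp hq hpq).1
  rw [mem_extremePoints_planarBall_iff] at h
  have hd : (1 + δ) ≠ 0 := by linarith
  obtain ⟨h1, -, h3⟩ := h.2 0 0 1 _ _ _ (δ / (1 + δ)) (1 / (1 + δ)) (by positivity)
    (by positivity) (by field_simp; ring) hapex hmem (by field_simp; ring) (by field_simp; ring)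
    (by field_simp; ring)
  exact ⟨h1.symm, h3.symm⟩

lemma left_mem_of_linear_extreme {p q a c : ℝ} (hp : 0 < p) (hq : 0 < q) (hpq : p + q = 1)
    (ha : a ∈ Icc (-1 : ℝ) 1) (hc : c ∈ Icc (-1 : ℝ) 1) (h1 : -(p * a) < q * (1 - c))
    (h2 : -(q * c) < p * (1 - a))
    (h : (a, 1 - a - c, c) ∈ extremePoints ℝ (planarBall p q)) : a = 1 ∨ a = -1 := by
  by_contra! hne
  have ha0 : -1 < a := lt_of_le_of_ne ha.1 (Ne.symm hne.2)
  have ha1 : a < 1 := lt_of_le_of_ne ha.2 hne.1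
  obtain ⟨δ, hδ, hδ1, hδ2, hδ3, hδ4⟩ : ∃ δ : ℝ, 0 < δ ∧ δ ≤ 1 + a ∧ δ ≤ 1 - a ∧
      δ ≤ q * (1 - c) + p * a ∧ δ ≤ p * (1 - a) + q * c :=
    ⟨min (min (1 + a) (1 - a)) (min (q * (1 - c) + p * a) (p * (1 - a) + q * c)),
      lt_min (lt_min (by linarith) (by linarith)) (lt_min (by linarith) (by linarith)),
      by simp, by simp, by simp, by simp⟩
  have hpδ : p * δ ≤ δ := mul_le_of_le_one_left hδ.le (by linarith)
  have hpδ0 : 0 < p * δ := mul_pos hp hδ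
  have hmem1 := linear_mem_planarBall (a := a + δ) (c := c) hp hq hpq
    ⟨by linarith, by linarith⟩ hc (by linarith) (by linarith)
  have hmem2 := linear_mem_planarBall (a := a - δ) (c := c) hp hq hpq
    ⟨by linarith, by linarith⟩ hc (by linarith) (by linarith)
  have := not_extreme_of_add_sub_mem (α := δ) (β := -δ) (γ := 0) h
    (by convert hmem1 using 3 <;> ring) (by convert hmem2 using 3 <;> ring)
  exact hδ.ne' this.1

lemma upperExtreme_of_envelope {p q a c : ℝ} (hp : 0 < p) (hq : 0 < q) (hpq : p + q = 1)
    (ha : a ∈ Icc (-1 : ℝ) 1) (hc : c ∈ Icc (-1 : ℝ) 1)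
    (h : (a, upperEnvelope p q a c, c) ∈ extremePoints ℝ (planarBall p q)) :
    UpperExtreme p q a (upperEnvelope p q a c) c := by
  have hqp : q + p = 1 := by linarith
  unfold upperEnvelope at h ⊢
  split_ifs at h ⊢ with h1 h2
  · rcases amgmExtreme_or_apex hp hq hpq ha hc h1 h with h | ⟨rfl, rfl⟩
    · exact Or.inl h
    · simp [UpperExtreme, Real.zero_rpow hp.ne']
  · rcases amgmExtreme_or_apex hq hp hqp hc ha h2 (swap_mem_extremePoints h) with h | ⟨rfl, rfl⟩
    · exact Or.inr (Or.inl h)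
    · simp [UpperExtreme, Real.zero_rpow hq.ne']
  · push Not at h1 h2
    have hswap := swap_mem_extremePoints h
    rw [sub_right_comm] at hswap
    rcases left_mem_of_linear_extreme hp hq hpq ha hc h1 h2 h with rfl | rfl <;>
    rcases left_mem_of_linear_extreme hq hp hqp hc ha h2 h1 hswap with rfl | rfl
    · simp [UpperExtreme]
    · linarith
    · linarith
    · right; right; right; right; right
      exact ⟨rfl, by norm_num, rfl, by linarith, by linarith⟩

theorem mem_extremePoints_planarBall {p q a b c : ℝ} (hp : 0 < p) (hq : 0 < q) (hpq : p + q = 1) :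
    (a, b, c) ∈ extremePoints ℝ (planarBall p q) ↔
      UpperExtreme p q a b c ∨ UpperExtreme p q (-a) (-b) (-c) := by
  constructor
  · intro h
    have ha := left_mem_Icc hp h.1
    have hc := right_mem_Icc hq h.1
    have hb := (mem_planarBall_iff hp hq hpq ha hc).1 h.1
    by_cases h1 : b = upperEnvelope p q a c
    · left
      rw [h1] at h ⊢
      exact upperExtreme_of_envelope hp hq hpq ha hc h
    by_cases h2 : -b = upperEnvelope p q (-a) (-c)
    · right
      have h' := neg_mem_extremePoints h
      rw [h2] at h' ⊢
      exact upperExtreme_of_envelope hp hq hpq ⟨by linarith [ha.2], by linarith [ha.1]⟩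
        ⟨by linarith [hc.2], by linarith [hc.1]⟩ h'
    exfalso
    have h3 := lt_of_le_of_ne hb.1 h1
    have h4 := lt_of_le_of_ne hb.2 h2
    obtain ⟨δ, hδ, hδ1, hδ2⟩ : ∃ δ : ℝ, 0 < δ ∧ δ ≤ upperEnvelope p q a c - b ∧
        δ ≤ upperEnvelope p q (-a) (-c) + b :=
      ⟨min (upperEnvelope p q a c - b) (upperEnvelope p q (-a) (-c) + b),
        lt_min (by linarith) (by linarith), min_le_left _ _, min_le_right _ _⟩
    have := not_extreme_of_add_sub_mem (α := 0) (β := δ) (γ := 0) h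
      (by rw [add_zero, add_zero, mem_planarBall_iff hp hq hpq ha hc]
          exact ⟨by linarith, by linarith⟩)
      (by rw [sub_zero, sub_zero, mem_planarBall_iff hp hq hpq ha hc]
          exact ⟨by linarith, by linarith⟩)
    exact hδ.ne' this.2.1
  · rintro (h | h)
    · exact h.mem_extremePoints hp hq hpq
    · simpa using neg_mem_extremePoints (h.mem_extremePoints hp hq hpq)

lemma amgmExtreme_iff_of_le {p q a b c : ℝ} (hp : 0 < p) (hq : 0 < q) (h : p ≤ 2 * q) :
    AmgmExtreme p q a b c ↔
      a = -1 ∧ c ∈ Icc (1 + -(p / q)) 1 ∧ b = amgmConst p q * (1 - c) ^ p := by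
  have hdiv : p / q ≤ 2 := (div_le_iff₀ hq).2 h
  have hmul : q * (p / q) = p := mul_div_cancel₀ _ hq.ne'
  constructor
  · rintro ⟨ha, hc, hedge, hac, rfl⟩
    have ha1 : a = -1 := by
      rcases hedge with h1 | rfl
      · exact h1
      · nlinarith
    subst ha1
    refine ⟨rfl, ⟨le_of_mul_le_mul_left (a := q) ?_ hq, hc.2⟩, by simp⟩
    linarith
  · rintro ⟨rfl, hc, rfl⟩
    refine ⟨le_rfl, ⟨by linarith [hc.1], hc.2⟩, Or.inl rfl, ?_, by simp⟩
    have := mul_le_mul_of_nonneg_left hc.1 hq.le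
    linarith

lemma amgmExtreme_iff_of_ge {p q a b c : ℝ} (hp : 0 < p) (hq : 0 < q) (h : 2 * q ≤ p) :
    AmgmExtreme p q a b c ↔
      (a = -1 ∧ c ∈ Icc (-1 : ℝ) 1 ∧ b = amgmConst p q * (1 - c) ^ p) ∨
      (c = -1 ∧ a ∈ Icc (-1 : ℝ) (-(2 * q / p)) ∧ b = 2 ^ p * amgmConst p q * |a| ^ q) := by
  constructor
  · rintro ⟨ha, hc, rfl | rfl, hac, rfl⟩
    · exact Or.inl ⟨rfl, hc, by simp⟩
    · refine Or.inr ⟨rfl, ⟨ha, ?_⟩, ?_⟩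
      · rw [le_neg, div_le_iff₀ hp]; linarith
      · rw [abs_of_nonpos (by nlinarith), sub_neg_eq_add, one_add_one_eq_two]; ring
  · rintro (⟨rfl, hc, rfl⟩ | ⟨rfl, ha, rfl⟩)
    · exact ⟨le_rfl, hc, Or.inl rfl, by nlinarith [hc.1], by simp⟩
    · have h1 := ha.2
      have h2 : 0 < 2 * q / p := by positivity
      refine ⟨ha.1, by norm_num, Or.inr rfl, ?_, ?_⟩
      · rw [le_neg, div_le_iff₀ hp] at h1; linarith
      · rw [abs_of_nonpos (by linarith), sub_neg_eq_add, one_add_one_eq_two]; ring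

lemma exists_sign_smul_iff {I : Set ℝ} {f : ℝ → ℝ × ℝ × ℝ} {x : ℝ × ℝ × ℝ} :
    (∃ t ∈ I, ∃ ε ∈ ({-1, 1} : Set ℝ), x = ε • f t) ↔
      (∃ t ∈ I, x = f t) ∨ ∃ t ∈ I, -x = f t := by
  constructor
  · rintro ⟨t, ht, ε, rfl | rfl, rfl⟩
    · exact Or.inr ⟨t, ht, by simp⟩
    · exact Or.inl ⟨t, ht, by simp⟩
  · rintro (⟨t, ht, h⟩ | ⟨t, ht, h⟩)
    · exact ⟨t, ht, 1, by simp, by simpa using h⟩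
    · exact ⟨t, ht, -1, by simp, by simp [← h]⟩

lemma exists_graph_right_iff {I : Set ℝ} {f : ℝ → ℝ} {a b c r : ℝ} :
    (∃ t ∈ I, ((a, b, c) : ℝ × ℝ × ℝ) = (r, f t, t)) ↔ a = r ∧ c ∈ I ∧ b = f c := by
  simp only [Prod.mk.injEq]
  constructor
  · rintro ⟨t, ht, rfl, rfl, rfl⟩; exact ⟨rfl, ht, rfl⟩
  · rintro ⟨rfl, ht, rfl⟩; exact ⟨c, ht, rfl, rfl, rfl⟩

lemma exists_graph_left_iff {I : Set ℝ} {f : ℝ → ℝ} {a b c r : ℝ} :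
    (∃ t ∈ I, ((a, b, c) : ℝ × ℝ × ℝ) = (t, f t, r)) ↔ c = r ∧ a ∈ I ∧ b = f a := by
  simp only [Prod.mk.injEq]
  constructor
  · rintro ⟨t, ht, rfl, rfl, rfl⟩; exact ⟨rfl, ht, rfl⟩
  · rintro ⟨rfl, ht, rfl⟩; exact ⟨a, ht, rfl, rfl, rfl⟩

lemma Lc_eq_amgmConst {m n : ℕ} (hn0 : 0 < n) (hmn : n < m) :
    Lc m n = amgmConst ((n : ℝ) / m) (((m : ℝ) - n) / m) := by
  have hn : (0 : ℝ) < n := by exact_mod_cast hn0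
  have hm : (0 : ℝ) < m := by exact_mod_cast hn0.trans hmn
  have hd : (0 : ℝ) < (m : ℝ) - n := sub_pos.2 (by exact_mod_cast hmn)
  unfold Lc
  have hp : (0 : ℝ) < (n : ℝ) / m := by positivity
  have hq : (0 : ℝ) < ((m : ℝ) - n) / m := by positivity
  have hpq : (n : ℝ) / m + ((m : ℝ) - n) / m = 1 := by field_simp; ring
  have h1 : (m : ℝ) / ((m : ℝ) - n) = (((m : ℝ) - n) / m)⁻¹ := by rw [inv_div]
  have h2 : ((m : ℝ) - n) / n = ((m : ℝ) - n) / m / ((n : ℝ) / m) := by field_simp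
  rw [h1, h2]
  generalize (n : ℝ) / m = p at *
  generalize ((m : ℝ) - n) / m = q at *
  have h3 : q ^ p * q ^ q = q := by rw [← Real.rpow_add hq, hpq, Real.rpow_one]
  rw [Real.div_rpow hq.le hp.le]
  unfold amgmConst
  have h4 := Real.rpow_pos_of_pos hp p
  have h5 := Real.rpow_pos_of_pos hq q
  field_simp
  linarith

lemma homNorm_le_one_iff {m n : ℕ} {a b c : ℝ} : homNorm m n a b c ≤ 1 ↔
    ∀ x ∈ Icc (-1 : ℝ) 1, ∀ y ∈ Icc (-1 : ℝ) 1,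
      |a * x ^ m + b * x ^ (m - n) * y ^ n + c * y ^ m| ≤ 1 := by
  unfold homNorm
  rw [csSup_le_iff]
  · constructor
    · intro h x hx y hy
      exact h _ ⟨(x, y), ⟨hx, hy⟩, rfl⟩
    · rintro h _ ⟨⟨x, y⟩, ⟨hx, hy⟩, rfl⟩
      exact h x hx y hy
  · exact ((isCompact_Icc.prod isCompact_Icc).image (by fun_prop)).bddAbove
  · exact ⟨_, (0, 0), by simp, rfl⟩

lemma homBall_eq_planarBall {m n : ℕ} (hm : Even m) (hn : Even n) (hn0 : 0 < n) (hmn : n < m) :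
    homBall m n = planarBall ((n : ℝ) / m) (((m : ℝ) - n) / m) := by
  have hm0 : m ≠ 0 := by omega
  have hmR : (m : ℝ) ≠ 0 := by exact_mod_cast hm0
  have hd : Even (m - n) := by grind
  have hmq : (m : ℝ) * (((m : ℝ) - n) / m) = ((m - n : ℕ) : ℝ) := by
    rw [Nat.cast_sub hmn.le]; field_simp
  have hmp : (m : ℝ) * ((n : ℝ) / m) = n := by field_simp
  have key : ∀ x y : ℝ, 0 ≤ x → 0 ≤ y →
      (x ^ m) ^ (((m : ℝ) - n) / m) * (y ^ m) ^ ((n : ℝ) / m) = x ^ (m - n) * y ^ n := by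
    intro x y hx hy
    rw [← Real.rpow_natCast_mul hx, ← Real.rpow_natCast_mul hy, hmq, hmp, Real.rpow_natCast,
      Real.rpow_natCast]
  ext ⟨a, b, c⟩
  rw [mk_mem_planarBall]
  change homNorm m n a b c ≤ 1 ↔ _
  rw [homNorm_le_one_iff]
  constructor
  · intro h
    have h' : ∀ u ∈ Icc (0 : ℝ) 1, ∀ v ∈ Icc (0 : ℝ) 1,
        |a * u + b * (u ^ (((m : ℝ) - n) / m) * v ^ ((n : ℝ) / m)) + c * v| ≤ 1 := by
      have root : ∀ u ∈ Icc (0 : ℝ) 1, ∃ x ∈ Icc (0 : ℝ) 1, x ^ m = u := fun u hu =>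
        ⟨u ^ ((m : ℝ)⁻¹), ⟨Real.rpow_nonneg hu.1 _, Real.rpow_le_one hu.1 hu.2 (by positivity)⟩,
          Real.rpow_inv_natCast_pow hu.1 hm0⟩
      intro u hu v hv
      obtain ⟨x, hx, rfl⟩ := root u hu
      obtain ⟨y, hy, rfl⟩ := root v hv
      rw [key x y hx.1 hy.1, ← mul_assoc]
      exact h x ⟨by linarith [hx.1], hx.2⟩ y ⟨by linarith [hy.1], hy.2⟩
    exact ⟨fun u hu v hv => (abs_le.1 (h' u hu v hv)).2,
      fun u hu v hv => by linarith [(abs_le.1 (h' u hu v hv)).1]⟩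
  · rintro ⟨h1, h2⟩ x hx y hy
    have hx' : |x| ^ m ∈ Icc (0 : ℝ) 1 :=
      ⟨by positivity, pow_le_one₀ (abs_nonneg x) (abs_le.2 hx)⟩
    have hy' : |y| ^ m ∈ Icc (0 : ℝ) 1 :=
      ⟨by positivity, pow_le_one₀ (abs_nonneg y) (abs_le.2 hy)⟩
    have h3 := h1 _ hx' _ hy'
    have h4 := h2 _ hx' _ hy'
    rw [key _ _ (abs_nonneg x) (abs_nonneg y), hm.pow_abs, hm.pow_abs, hn.pow_abs, hd.pow_abs]
      at h3 h4
    exact abs_le.2 ⟨by linarith, by linarith⟩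

theorem stmt5 (m n : ℕ) (hm : Even m) (hn : Even n) (hn0 : 0 < n) (hmn : n < m) :
    ((n : ℝ) / m ∈ Ioo (0 : ℝ) (1 / 3) →
      Set.extremePoints ℝ (homBall m n) =
        {x : ℝ × ℝ × ℝ | ∃ c ∈ Icc (1 + lam0 m n) (1 : ℝ), ∃ ε ∈ ({-1, 1} : Set ℝ),
            x = ε • (((-1 : ℝ), Lc m n * (1 - c) ^ ((n : ℝ) / m), c) : ℝ × ℝ × ℝ)}
        ∪ {x : ℝ × ℝ × ℝ | ∃ c ∈ Icc (-1 : ℝ) (2 * lam0 m n), ∃ ε ∈ ({-1, 1} : Set ℝ),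
            x = ε • (((-1 : ℝ), Rc m n * |c| ^ ((n : ℝ) / m), c) : ℝ × ℝ × ℝ)}
        ∪ {x : ℝ × ℝ × ℝ | ∃ a ∈ Icc (-1 : ℝ) (1 : ℝ), ∃ ε ∈ ({-1, 1} : Set ℝ),
            x = ε • ((a, Lc m n * (1 - a) ^ (((m : ℝ) - n) / m), (-1 : ℝ)) : ℝ × ℝ × ℝ)}
        ∪ {((0 : ℝ), (0 : ℝ), (1 : ℝ)), ((0 : ℝ), (0 : ℝ), (-1 : ℝ)),
            ((1 : ℝ), (0 : ℝ), (0 : ℝ)), ((-1 : ℝ), (0 : ℝ), (0 : ℝ)),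
            ((1 : ℝ), (-1 : ℝ), (1 : ℝ)), ((-1 : ℝ), (1 : ℝ), (-1 : ℝ))}) ∧
    ((n : ℝ) / m ∈ Icc (1 / 3 : ℝ) (2 / 3) →
      Set.extremePoints ℝ (homBall m n) =
        {x : ℝ × ℝ × ℝ | ∃ c ∈ Icc (1 + lam0 m n) (1 : ℝ), ∃ ε ∈ ({-1, 1} : Set ℝ),
            x = ε • (((-1 : ℝ), Lc m n * (1 - c) ^ ((n : ℝ) / m), c) : ℝ × ℝ × ℝ)}
        ∪ {x : ℝ × ℝ × ℝ | ∃ a ∈ Icc (1 + 1 / lam0 m n) (1 : ℝ), ∃ ε ∈ ({-1, 1} : Set ℝ),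
            x = ε • ((a, Lc m n * (1 - a) ^ (((m : ℝ) - n) / m), (-1 : ℝ)) : ℝ × ℝ × ℝ)}
        ∪ {((0 : ℝ), (0 : ℝ), (1 : ℝ)), ((0 : ℝ), (0 : ℝ), (-1 : ℝ)),
            ((1 : ℝ), (0 : ℝ), (0 : ℝ)), ((-1 : ℝ), (0 : ℝ), (0 : ℝ)),
            ((1 : ℝ), (-1 : ℝ), (1 : ℝ)), ((-1 : ℝ), (1 : ℝ), (-1 : ℝ)),
            ((1 : ℝ), (-3 : ℝ), (1 : ℝ)), ((-1 : ℝ), (3 : ℝ), (-1 : ℝ))}) ∧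
    ((n : ℝ) / m ∈ Ioo (2 / 3 : ℝ) 1 →
      Set.extremePoints ℝ (homBall m n) =
        {x : ℝ × ℝ × ℝ | ∃ c ∈ Icc (-1 : ℝ) (1 : ℝ), ∃ ε ∈ ({-1, 1} : Set ℝ),
            x = ε • (((-1 : ℝ), Lc m n * (1 - c) ^ ((n : ℝ) / m), c) : ℝ × ℝ × ℝ)}
        ∪ {x : ℝ × ℝ × ℝ | ∃ a ∈ Icc (-1 : ℝ) (2 / lam0 m n), ∃ ε ∈ ({-1, 1} : Set ℝ),
            x = ε • ((a, Rc m (m - n) * |a| ^ (((m : ℝ) - n) / m), (-1 : ℝ)) : ℝ × ℝ × ℝ)}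
        ∪ {x : ℝ × ℝ × ℝ | ∃ a ∈ Icc (1 + 1 / lam0 m n) (1 : ℝ), ∃ ε ∈ ({-1, 1} : Set ℝ),
            x = ε • ((a, Lc m n * (1 - a) ^ (((m : ℝ) - n) / m), (-1 : ℝ)) : ℝ × ℝ × ℝ)}
        ∪ {((0 : ℝ), (0 : ℝ), (1 : ℝ)), ((0 : ℝ), (0 : ℝ), (-1 : ℝ)),
            ((1 : ℝ), (0 : ℝ), (0 : ℝ)), ((-1 : ℝ), (0 : ℝ), (0 : ℝ)),
            ((1 : ℝ), (-1 : ℝ), (1 : ℝ)), ((-1 : ℝ), (1 : ℝ), (-1 : ℝ))}) := by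
  have hnR : (0 : ℝ) < n := by exact_mod_cast hn0
  have hmR : (0 : ℝ) < m := by exact_mod_cast hn0.trans hmn
  have hdR : (0 : ℝ) < (m : ℝ) - n := sub_pos.2 (by exact_mod_cast hmn)
  have hL := Lc_eq_amgmConst hn0 hmn
  have hL' : Lc m (m - n) = amgmConst (((m : ℝ) - n) / m) ((n : ℝ) / m) := by
    rw [Lc_eq_amgmConst (by omega) (by omega), Nat.cast_sub hmn.le, sub_sub_cancel]
  have hR : Rc m n = 2 ^ (((m : ℝ) - n) / m) * Lc m n := rfl
  have hR' : Rc m (m - n) = 2 ^ ((n : ℝ) / m) * Lc m (m - n) := by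
    rw [Rc, Nat.cast_sub hmn.le, sub_sub_cancel]
  have hlam : lam0 m n = -((n : ℝ) / m / (((m : ℝ) - n) / m)) := by
    rw [lam0]; field_simp
  have hp : (0 : ℝ) < (n : ℝ) / m := by positivity
  have hq : (0 : ℝ) < ((m : ℝ) - n) / m := by positivity
  have hpq : (n : ℝ) / m + ((m : ℝ) - n) / m = 1 := by field_simp; ring
  have hball := homBall_eq_planarBall hm hn hn0 hmn
  rw [hR', hR, hL', hL, amgmConst_comm (((m : ℝ) - n) / m), hlam, hball]
  clear hR' hR hL' hL hlam hball
  generalize (n : ℝ) / m = p at *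
  generalize ((m : ℝ) - n) / m = q at *
  have hinv : 1 / -(p / q) = -(q / p) := by field_simp
  have hinv2 : 2 / -(p / q) = -(2 * q / p) := by field_simp
  have hinv3 : 2 * -(p / q) = -(2 * p / q) := by ring
  rw [hinv, hinv2, hinv3]
  have hpts : ∀ a r : ℝ, -a = r ↔ a = -r := fun a r => neg_eq_iff_eq_neg
  refine ⟨fun h => ?_, fun h => ?_, fun h => ?_⟩
  · ext ⟨a, b, c⟩
    have h1 := h.2
    simp only [mem_union, mem_ofPred_eq, exists_sign_smul_iff, Prod.neg_mk, exists_graph_right_iff,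
      exists_graph_left_iff]
    simp only [mem_extremePoints_planarBall hp hq hpq, UpperExtreme,
      amgmExtreme_iff_of_le hp hq (show p ≤ 2 * q by linarith),
      amgmExtreme_iff_of_ge hq hp (show 2 * p ≤ q by linarith), amgmConst_comm q p,
      show ¬ q ≤ 2 * p by linarith, mem_insert_iff, mem_singleton_iff, Prod.mk.injEq, and_false,
      or_false]
    simp only [hpts _ 0, hpts _ 1, hpts _ (-1), neg_zero, neg_neg]
    constructor <;> intro h <;> casesm* _ ∨ _ <;> simp only [*, and_self, true_or, or_true]
  · ext ⟨a, b, c⟩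
    obtain ⟨h1, h2⟩ := h
    simp only [mem_union, mem_ofPred_eq, exists_sign_smul_iff, Prod.neg_mk, exists_graph_right_iff,
      exists_graph_left_iff]
    simp only [mem_extremePoints_planarBall hp hq hpq, UpperExtreme,
      amgmExtreme_iff_of_le hp hq (show p ≤ 2 * q by linarith),
      amgmExtreme_iff_of_le hq hp (show q ≤ 2 * p by linarith), amgmConst_comm q p,
      show p ≤ 2 * q by linarith, show q ≤ 2 * p by linarith,
      mem_insert_iff, mem_singleton_iff, Prod.mk.injEq, and_true]
    simp only [hpts _ 0, hpts _ 1, hpts _ (-1), hpts _ 3, neg_zero, neg_neg]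
    constructor <;> intro h <;> casesm* _ ∨ _ <;> simp only [*, and_self, true_or, or_true]
  · ext ⟨a, b, c⟩
    have h1 := h.1
    simp only [mem_union, mem_ofPred_eq, exists_sign_smul_iff, Prod.neg_mk, exists_graph_right_iff,
      exists_graph_left_iff]
    simp only [mem_extremePoints_planarBall hp hq hpq, UpperExtreme,
      amgmExtreme_iff_of_ge hp hq (show 2 * q ≤ p by linarith),
      amgmExtreme_iff_of_le hq hp (show q ≤ 2 * p by linarith), amgmConst_comm q p,
      show ¬ p ≤ 2 * q by linarith, mem_insert_iff, mem_singleton_iff, Prod.mk.injEq, and_false,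
      false_and, or_false]
    simp only [hpts _ 0, hpts _ 1, hpts _ (-1), neg_zero, neg_neg]
    constructor <;> intro h <;> casesm* _ ∨ _ <;> simp only [*, and_self, true_or, or_true]
end

section
/- Let $m,n$ be positive integers with $m$ even, $n$ odd and $m>n$. Let $\mathcal{I}_{m,n}$ be the set of triples $(a,b,c)\in\mathbb{R}^3$ such that $a\neq 0$, $|\tfrac{nb}{ma}|<1$ and $1+\tfrac{c}{a}<\tfrac12\big[\tfrac{m-n}{n}\,|\tfrac{nb}{ma}|^{m/(m-n)}-|\tfrac{b}{a}|+1\big]$. Then for every $(a,b,c)\in\mathbb{R}^3$: $\|(a,b,c)\|_{m,n}=\big|\tfrac{(m-n)a}{n}\,|\tfrac{nb}{ma}|^{m/(m-n)}-c\big|$ if $(a,b,c)\in\mathcal{I}_{m,n}$, and $\|(a,b,c)\|_{m,n}=|a+c|+|b|$ otherwise. -/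
open Set

/-- The region `𝓘_{m,n}` of triples `(a,b,c)`. -/
noncomputable def Iset (m n : ℕ) : Set (ℝ × ℝ × ℝ) :=
  {p | p.1 ≠ 0 ∧ |(n : ℝ) * p.2.1 / (m * p.1)| < 1 ∧
    1 + p.2.2 / p.1 <
      (1 / 2) * (((m : ℝ) - n) / n *
          |(n : ℝ) * p.2.1 / (m * p.1)| ^ ((m : ℝ) / ((m : ℝ) - n)) -
        |p.2.1 / p.1| + 1)}

theorem lineNorm_eq_of_forall_le {m n : ℕ} {a b c V : ℝ}
    (hle : ∀ x ∈ Icc (-1 : ℝ) 1, |a * x ^ m + b * x ^ n + c| ≤ V)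
    (hex : ∃ x ∈ Icc (-1 : ℝ) 1, |a * x ^ m + b * x ^ n + c| = V) :
    lineNorm m n a b c = V := by
  refine IsGreatest.csSup_eq ⟨hex, ?_⟩
  rintro _ ⟨x, hx, rfl⟩
  exact hle x hx

theorem lineNorm_eq_endpoint {m n : ℕ} (hm : Even m) (hn : Odd n) {a b c : ℝ}
    (hle : ∀ x ∈ Icc (-1 : ℝ) 1, |a * x ^ m + b * x ^ n + c| ≤ |a + c| + |b|) :
    lineNorm m n a b c = |a + c| + |b| := by
  refine lineNorm_eq_of_forall_le hle ?_
  rcases le_total 0 ((a + c) * b) with h | h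
  · refine ⟨1, by norm_num, ?_⟩
    rw [one_pow, one_pow, ← abs_add_eq_add_abs_iff _ _ |>.2 (mul_nonneg_iff.1 h)]
    congr 1
    ring
  · refine ⟨-1, by norm_num, ?_⟩
    have h' : 0 ≤ (a + c) * (-b) := by linarith
    rw [hm.neg_one_pow, hn.neg_one_pow, ← abs_neg b,
      ← abs_add_eq_add_abs_iff _ _ |>.2 (mul_nonneg_iff.1 h')]
    congr 1
    ring

/-- Young's inequality with the conjugate exponents `m / (m - n)` and `m / n`. -/
theorem young_trinomial {m n : ℕ} (hn : 0 < n) (hmn : n < m) {q t : ℝ} (hq : 0 ≤ q)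
    (ht : 0 ≤ t) :
    (m : ℝ) / n * q * t ^ n ≤
      t ^ m + ((m : ℝ) - n) / n * q ^ ((m : ℝ) / ((m : ℝ) - n)) := by
  have hn' : (0 : ℝ) < n := by exact_mod_cast hn
  have hmn' : (0 : ℝ) < (m : ℝ) - n := sub_pos.2 (by exact_mod_cast hmn)
  have hm' : (0 : ℝ) < m := by linarith
  have hconj : ((m : ℝ) / ((m : ℝ) - n)).HolderConjugate ((m : ℝ) / n) := by
    rw [Real.holderConjugate_iff]
    refine ⟨(one_lt_div hmn').2 (by linarith), ?_⟩
    rw [inv_div, inv_div]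
    field_simp
    ring
  have hy := Real.young_inequality_of_nonneg hq (pow_nonneg ht n) hconj
  have hpow : (t ^ n) ^ ((m : ℝ) / n) = t ^ m := by
    rw [← Real.rpow_natCast t n, ← Real.rpow_mul ht, mul_div_cancel₀ _ hn'.ne',
      Real.rpow_natCast]
  rw [hpow] at hy
  calc (m : ℝ) / n * q * t ^ n = (m : ℝ) / n * (q * t ^ n) := by ring
    _ ≤ (m : ℝ) / n * _ := mul_le_mul_of_nonneg_left hy (by positivity)
    _ = _ := by field_simp; ring

theorem exists_trinomial_eq_min {m n : ℕ} (hm : Even m) (hn : Odd n) (hmn : n < m) {β : ℝ}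
    (hq : (n : ℝ) / m * |β| ≤ 1) :
    ∃ x ∈ Icc (-1 : ℝ) 1, x ^ m + β * x ^ n =
      -(((m : ℝ) - n) / n * ((n : ℝ) / m * |β|) ^ ((m : ℝ) / ((m : ℝ) - n))) := by
  have hn' : (0 : ℝ) < n := by exact_mod_cast hn.pos
  have hmn' : (0 : ℝ) < (m : ℝ) - n := sub_pos.2 (by exact_mod_cast hmn)
  have hm' : (0 : ℝ) < m := by linarith
  set q : ℝ := (n : ℝ) / m * |β| with hqdef
  have hq0 : 0 ≤ q := by positivity
  have hβ : |β| = (m : ℝ) / n * q := by rw [hqdef]; field_simp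
  set t : ℝ := q ^ (1 / ((m : ℝ) - n)) with htdef
  have ht0 : 0 ≤ t := Real.rpow_nonneg hq0 _
  have ht1 : t ≤ 1 := Real.rpow_le_one hq0 hq (by positivity)
  have htm : t ^ m = q ^ ((m : ℝ) / ((m : ℝ) - n)) := by
    rw [htdef, ← Real.rpow_natCast, ← Real.rpow_mul hq0]
    congr 1
    ring
  have htq : t ^ (m - n) = q := by
    rw [htdef, ← Real.rpow_natCast, ← Real.rpow_mul hq0, Nat.cast_sub hmn.le,
      one_div_mul_cancel hmn'.ne', Real.rpow_one]
  have hqt : q * t ^ n = t ^ m := by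
    rw [← htq, ← pow_add, Nat.sub_add_cancel hmn.le]
  have hval : t ^ m - |β| * t ^ n = -(((m : ℝ) - n) / n * t ^ m) := by
    rw [hβ, mul_assoc, hqt]
    field_simp
    ring
  rw [← htm, ← hval]
  rcases le_total β 0 with h | h
  · refine ⟨t, ⟨by linarith, ht1⟩, ?_⟩
    rw [abs_of_nonpos h]
    ring
  · refine ⟨-t, ⟨by linarith, by linarith⟩, ?_⟩
    rw [abs_of_nonneg h, hm.neg_pow, hn.neg_pow]
    ring

theorem trinomial_bounds {m n : ℕ} (hm : Even m) (β : ℝ) {x : ℝ}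
    (hx : x ∈ Icc (-1 : ℝ) 1) :
    |x| ^ m - |β| * |x| ^ n ≤ x ^ m + β * x ^ n ∧ x ^ m + β * x ^ n ≤ 1 + |β| := by
  have hx1 : |x| ≤ 1 := abs_le.2 hx
  have hxm : |x| ^ m = x ^ m := hm.pow_abs x
  have h1 : x ^ m ≤ 1 := hxm ▸ pow_le_one₀ (abs_nonneg x) hx1
  have h2 : |β * x ^ n| = |β| * |x| ^ n := by rw [abs_mul, abs_pow]
  have h3 := abs_le.1 h2.le
  have h4 : |β| * |x| ^ n ≤ |β| :=
    mul_le_of_le_one_right (abs_nonneg β) (pow_le_one₀ (abs_nonneg x) hx1)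
  constructor <;> linarith [h3.1, h3.2]

theorem neg_le_trinomial {m n : ℕ} (hm : Even m) (hn : 0 < n) (hmn : n < m) (β : ℝ) {x : ℝ}
    (hx : x ∈ Icc (-1 : ℝ) 1) :
    -(((m : ℝ) - n) / n * ((n : ℝ) / m * |β|) ^ ((m : ℝ) / ((m : ℝ) - n))) ≤
      x ^ m + β * x ^ n := by
  have hn' : (0 : ℝ) < n := by exact_mod_cast hn
  have hm' : (0 : ℝ) < m := by exact_mod_cast hn.trans hmn
  have hy := young_trinomial hn hmn (q := (n : ℝ) / m * |β|) (by positivity) (abs_nonneg x)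
  rw [show (m : ℝ) / n * ((n : ℝ) / m * |β|) = |β| by field_simp] at hy
  linarith [(trinomial_bounds (n := n) hm β hx).1]

theorem one_sub_abs_le_trinomial {m n : ℕ} (hm : Even m) (hn : 0 < n) (hmn : n < m) {β : ℝ}
    (hβ : 1 ≤ (n : ℝ) / m * |β|) {x : ℝ} (hx : x ∈ Icc (-1 : ℝ) 1) :
    1 - |β| ≤ x ^ m + β * x ^ n := by
  have hn' : (0 : ℝ) < n := by exact_mod_cast hn
  have hm' : (0 : ℝ) < m := by exact_mod_cast hn.trans hmn
  have hy := young_trinomial hn hmn zero_le_one (abs_nonneg x)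
  rw [Real.one_rpow, mul_one, mul_one, sub_div, div_self hn'.ne'] at hy
  have hβ' : (m : ℝ) / n ≤ |β| := by
    rw [div_mul_eq_mul_div, le_div_iff₀ hm'] at hβ
    rw [div_le_iff₀ hn']
    linarith
  have hpow : |x| ^ n ≤ 1 := pow_le_one₀ (abs_nonneg x) (abs_le.2 hx)
  nlinarith [(trinomial_bounds (n := n) hm β hx).1,
    mul_nonneg (sub_nonneg.2 hβ') (sub_nonneg.2 hpow)]

theorem stmt6 (m n : ℕ) (hm : Even m) (hn : Odd n) (hmn : n < m) :
    ∀ a b c : ℝ,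
      ((a, b, c) ∈ Iset m n →
        lineNorm m n a b c =
          |((m : ℝ) - n) * a / n * |(n : ℝ) * b / (m * a)| ^ ((m : ℝ) / ((m : ℝ) - n)) - c|) ∧
      ((a, b, c) ∉ Iset m n → lineNorm m n a b c = |a + c| + |b|) := by
  intro a b c
  have hn' : (0 : ℝ) < n := by exact_mod_cast hn.pos
  have hmn' : (0 : ℝ) < (m : ℝ) - n := sub_pos.2 (by exact_mod_cast hmn)
  have hm' : (0 : ℝ) < m := by linarith
  rcases eq_or_ne a 0 with rfl | ha
  · refine ⟨fun h => absurd rfl h.1, fun _ => lineNorm_eq_endpoint hm hn fun x hx => ?_⟩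
    have hb : |b * x ^ n| ≤ |b| := by
      rw [abs_mul, abs_pow]
      exact mul_le_of_le_one_right (abs_nonneg b)
        (pow_le_one₀ (abs_nonneg x) (abs_le.2 hx))
    rw [zero_mul, zero_add, zero_add, add_comm |c|]
    exact (abs_add_le _ _).trans (by linarith)
  obtain ⟨β, rfl⟩ : ∃ β, b = a * β := ⟨b / a, by field_simp⟩
  obtain ⟨γ, rfl⟩ : ∃ γ, c = a * γ := ⟨c / a, by field_simp⟩
  have hq : |(n : ℝ) * (a * β) / (m * a)| = (n : ℝ) / m * |β| := by
    rw [show (n : ℝ) * (a * β) / (m * a) = (n : ℝ) / m * β by field_simp, abs_mul,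
      abs_of_pos (by positivity : (0 : ℝ) < (n : ℝ) / m)]
  have hfactor : ∀ x : ℝ, |a * x ^ m + a * β * x ^ n + a * γ| =
      |a| * |x ^ m + β * x ^ n + γ| := fun x => by
    rw [← abs_mul]
    congr 1
    ring
  have hK := young_trinomial hn.pos hmn (q := (n : ℝ) / m * |β|) (by positivity) zero_le_one
  rw [show (m : ℝ) / n * ((n : ℝ) / m * |β|) = |β| by field_simp, one_pow, one_pow,
    mul_one] at hK
  have hKnonneg : 0 ≤ ((m : ℝ) - n) / n *
      ((n : ℝ) / m * |β|) ^ ((m : ℝ) / ((m : ℝ) - n)) := by positivity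
  have hmin : ∀ x ∈ Icc (-1 : ℝ) 1, _ := fun x hx => neg_le_trinomial hm hn.pos hmn β hx
  have hmax : ∀ x ∈ Icc (-1 : ℝ) 1, x ^ m + β * x ^ n ≤ 1 + |β| := fun x hx =>
    (trinomial_bounds hm β hx).2
  simp only [Iset, mem_ofPred_eq, hq, mul_div_cancel_left₀ _ ha]
  have hval : |((m : ℝ) - n) * a / n * ((n : ℝ) / m * |β|) ^ ((m : ℝ) / ((m : ℝ) - n)) - a * γ| =
      |a| * |((m : ℝ) - n) / n * ((n : ℝ) / m * |β|) ^ ((m : ℝ) / ((m : ℝ) - n)) - γ| := by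
    rw [← abs_mul]
    congr 1
    ring
  rw [hval]
  have hattain := exists_trinomial_eq_min hm hn hmn (β := β)
  generalize ((m : ℝ) - n) / n * ((n : ℝ) / m * |β|) ^ ((m : ℝ) / ((m : ℝ) - n)) = K at *
  constructor
  · rintro ⟨-, hlt, hI⟩
    refine lineNorm_eq_of_forall_le (fun x hx => ?_) ?_
    · rw [hfactor]
      refine mul_le_mul_of_nonneg_left ?_ (abs_nonneg a)
      rw [abs_of_nonneg (by linarith [abs_nonneg β] : 0 ≤ K - γ), abs_le]
      constructor <;> linarith [hmin x hx, hmax x hx]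
    · obtain ⟨x, hx, hxK⟩ := hattain hlt.le
      refine ⟨x, hx, ?_⟩
      rw [hfactor, hxK, ← abs_neg (K - γ)]
      congr 2
      ring
  · intro hI
    refine lineNorm_eq_endpoint hm hn fun x hx => ?_
    rw [hfactor, show |a + a * γ| + |a * β| = |a| * (|1 + γ| + |β|) by
      rw [mul_add, ← abs_mul, ← abs_mul, mul_add, mul_one]]
    refine mul_le_mul_of_nonneg_left ?_ (abs_nonneg a)
    have hγ := le_abs_self (1 + γ)
    have hγ' := neg_abs_le (1 + γ)
    rcases lt_or_ge ((n : ℝ) / m * |β|) 1 with hlt | hge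
    · have hI' := not_lt.1 fun h => hI ⟨ha, hlt, h⟩
      rw [abs_le]
      constructor <;> linarith [hmin x hx, hmax x hx]
    · have hlow := one_sub_abs_le_trinomial hm hn.pos hmn hge hx
      rw [abs_le]
      constructor <;> linarith [hmax x hx]
end

section
/- Let $m,n$ be positive integers with $m$ even, $n$ odd and $m\ge 2n$, and set $K_{m,n}=\tfrac{n}{m-n}(\tfrac{m-n}{m})^{m/n}$. Then there exists a continuous, strictly decreasing function $\Lambda_{m,n}:[0,\tfrac{m}{m-n}]\to\mathbb{R}$ with $\Lambda_{m,n}(0)=0$ and $-1\le\Lambda_{m,n}(b)\le 0$ for all $b$, such that for every $b\in[0,\tfrac{m}{m-n}]$ the pair $t=\Lambda_{m,n}(b)$ satisfies $mK_{m,n}\,t\,b^{m/n}-nb-mt+(m-n)\,b\,|t|^{m/(m-n)}=0$. -/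
open Set

/-- A family of strictly increasing functions on `[0, 1]` that change sign there, depending
continuously on a parameter, has a root depending continuously on the parameter. -/
theorem exists_continuousOn_root {F : ℝ → ℝ → ℝ} {S : Set ℝ}
    (hcont : ∀ s ∈ Icc (0 : ℝ) 1, ContinuousOn (fun b => F b s) S)
    (hcont' : ∀ b ∈ S, ContinuousOn (F b) (Icc 0 1))
    (hmono : ∀ b ∈ S, StrictMonoOn (F b) (Icc 0 1))
    (h0 : ∀ b ∈ S, F b 0 ≤ 0) (h1 : ∀ b ∈ S, 0 ≤ F b 1) :
    ∃ σ : ℝ → ℝ, ContinuousOn σ S ∧ ∀ b ∈ S, σ b ∈ Icc (0 : ℝ) 1 ∧ F b (σ b) = 0 := by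
  have hroot : ∀ b, ∃ s, b ∈ S → s ∈ Icc (0 : ℝ) 1 ∧ F b s = 0 := by
    intro b
    by_cases hb : b ∈ S
    · obtain ⟨s, hs, hFs⟩ := intermediate_value_Icc zero_le_one (hcont' b hb) ⟨h0 b hb, h1 b hb⟩
      exact ⟨s, fun _ => ⟨hs, hFs⟩⟩
    · exact ⟨0, fun h => absurd h hb⟩
  choose σ hσ using hroot
  refine ⟨σ, fun b hb => ?_, hσ⟩
  obtain ⟨hσb, hFb⟩ := hσ b hb
  refine tendsto_order.2 ⟨fun a ha => ?_, fun a ha => ?_⟩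
  · rcases lt_or_ge a 0 with ha0 | ha0
    · filter_upwards [self_mem_nhdsWithin] with x hx
      exact ha0.trans_le (hσ x hx).1.1
    · have haI : a ∈ Icc (0 : ℝ) 1 := ⟨ha0, ha.le.trans hσb.2⟩
      have hlt : F b a < 0 := hFb ▸ hmono b hb haI hσb ha
      filter_upwards [self_mem_nhdsWithin, (hcont a haI b hb).eventually_lt_const hlt] with x hx hFx
      exact ((hmono x hx).lt_iff_lt haI (hσ x hx).1).1 (by rwa [(hσ x hx).2])
  · rcases lt_or_ge 1 a with ha1 | ha1
    · filter_upwards [self_mem_nhdsWithin] with x hx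
      exact (hσ x hx).1.2.trans_lt ha1
    · have haI : a ∈ Icc (0 : ℝ) 1 := ⟨hσb.1.trans ha.le, ha1⟩
      have hlt : 0 < F b a := hFb ▸ hmono b hb hσb haI ha
      filter_upwards [self_mem_nhdsWithin, (hcont a haI b hb).eventually_const_lt hlt] with x hx hFx
      exact ((hmono x hx).lt_iff_lt (hσ x hx).1 haI).1 (by rwa [(hσ x hx).2])

theorem stmt9 (m n : ℕ) (hm : Even m) (hn : Odd n) (h2n : 2 * n ≤ m) :
    ∃ Λ : ℝ → ℝ,
      ContinuousOn Λ (Icc (0 : ℝ) ((m : ℝ) / ((m : ℝ) - n))) ∧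
      StrictAntiOn Λ (Icc (0 : ℝ) ((m : ℝ) / ((m : ℝ) - n))) ∧
      Λ 0 = 0 ∧
      ∀ b ∈ Icc (0 : ℝ) ((m : ℝ) / ((m : ℝ) - n)),
        Λ b ∈ Icc (-1 : ℝ) 0 ∧
        (m : ℝ) * Kc m n * Λ b * b ^ ((m : ℝ) / n) - n * b - m * Λ b +
          ((m : ℝ) - n) * b * |Λ b| ^ ((m : ℝ) / ((m : ℝ) - n)) = 0 := by
  have hn1 : (1 : ℝ) ≤ n := by exact_mod_cast hn.pos
  have hmn : 2 * (n : ℝ) ≤ m := by exact_mod_cast h2n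
  have hd : 0 < (m : ℝ) - n := by linarith
  have hm0 : (0 : ℝ) < m := by linarith
  have hn0 : (0 : ℝ) < n := by linarith
  set q : ℝ := (m : ℝ) / n with hq
  set p : ℝ := (m : ℝ) / ((m : ℝ) - n) with hp
  have hq0 : 0 < q := by positivity
  have hp0 : 0 < p := by positivity
  have hK0 : 0 < Kc m n := by unfold Kc; positivity
  have hKp : Kc m n * p ^ q ≤ 1 := by
    have hinv : ((m : ℝ) - n) / m * p = 1 := by rw [hp]; field_simp
    rw [Kc, mul_assoc, ← Real.mul_rpow (by positivity) hp0.le, hinv, Real.one_rpow, mul_one,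
      div_le_one hd]
    linarith
  set c : ℝ → ℝ := fun b => m * (1 - Kc m n * b ^ q) with hc
  have hc_anti : ∀ {b b' : ℝ}, 0 ≤ b → b < b' → c b' < c b := by
    intro b b' hb hbb'
    have := mul_lt_mul_of_pos_left (Real.rpow_lt_rpow hb hbb' hq0) hK0
    exact mul_lt_mul_of_pos_left (by linarith) hm0
  have hc_nonneg : ∀ b ∈ Icc 0 p, 0 ≤ c b := by
    intro b hb
    have := mul_le_mul_of_nonneg_left (Real.rpow_le_rpow hb.1 hb.2 hq0.le) hK0.le
    exact mul_nonneg hm0.le (by linarith)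
  have hc_zero : c 0 = m := by simp [hc, Real.zero_rpow hq0.ne']
  have hc_cont : Continuous c := by
    have := Real.continuous_rpow_const hq0.le
    fun_prop
  have hpow_cont : Continuous fun s : ℝ => s ^ p := Real.continuous_rpow_const hp0.le
  set F : ℝ → ℝ → ℝ := fun b s => c b * s + ((m : ℝ) - n) * b * s ^ p - n * b with hF
  have hF_mono : ∀ b ∈ Icc 0 p, StrictMonoOn (F b) (Icc 0 1) := by
    intro b hb s hs s' hs' hss'
    have hpow := Real.rpow_lt_rpow hs.1 hss' hp0
    rcases hb.1.eq_or_lt with rfl | hb0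
    · simp only [hF, hc_zero]
      nlinarith
    · have h1 := mul_le_mul_of_nonneg_left hss'.le (hc_nonneg b hb)
      have h2 := mul_lt_mul_of_pos_left hpow (mul_pos hd hb0)
      simp only [hF]
      linarith
  have hF_zero : ∀ b, F b 0 = -(n * b) := by
    intro b
    simp [hF, Real.zero_rpow hp0.ne']
  obtain ⟨σ, hσ_cont, hσ⟩ := exists_continuousOn_root (F := F) (S := Icc 0 p)
    (fun s _ => by fun_prop) (fun b _ => by fun_prop) hF_mono
    (fun b hb => by rw [hF_zero]; nlinarith [hb.1])
    (fun b hb => by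
      have := hc_nonneg b hb
      simp only [hF, Real.one_rpow]
      nlinarith [hb.1])
  have hσ_zero : σ 0 = 0 := by
    have := (hσ 0 ⟨le_rfl, hp0.le⟩).2
    simpa [hF, hc_zero, hm0.ne'] using this
  refine ⟨fun b => -σ b, hσ_cont.neg, ?_, by simp [hσ_zero], fun b hb => ⟨?_, ?_⟩⟩
  · intro b hb b' hb' hbb'
    obtain ⟨hs, hFs⟩ := hσ b hb
    obtain ⟨hs', hFs'⟩ := hσ b' hb'
    refine neg_lt_neg (((hF_mono b' hb').lt_iff_lt hs hs').1 ?_)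
    rw [hFs']
    have hb'0 : 0 < b' := hb.1.trans_lt hbb'
    rcases hs.1.eq_or_lt with h0 | hs0
    · rw [← h0, hF_zero]
      nlinarith
    · have hb0 : 0 < b := by
        refine hb.1.lt_of_ne fun h => ?_
        rw [← h, hσ_zero] at hs0
        exact hs0.false
      have hlt : b * c b' < b' * c b :=
        (mul_lt_mul_of_pos_left (hc_anti hb.1 hbb') hb0).trans_le
          (mul_le_mul_of_nonneg_right hbb'.le (hc_nonneg b hb))
      have hkey : b * F b' (σ b) = b' * F b (σ b) + σ b * (b * c b' - b' * c b) := by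
        simp only [hF]
        ring
      rw [hFs] at hkey
      have : b * F b' (σ b) < 0 := by nlinarith
      exact (pos_iff_neg_of_mul_neg this).1 hb0
  · exact ⟨neg_le_neg (hσ b hb).1.2, neg_nonpos.2 (hσ b hb).1.1⟩
  · have hFb := (hσ b hb).2
    simp only [hF, hc] at hFb
    rw [abs_neg, abs_of_nonneg (hσ b hb).1.1]
    linarith
end

section
/- Let $m,n$ be positive integers with $m$ even, $n$ odd and $m>2n$. Then the equation $(m-n)|t|^{m/(m-n)}+(2n-m)t-n=0$ has exactly one solution $t$ in the open interval $(-1,0)$. -/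
open Set

/-- A strictly increasing continuous combination of `s ^ p` and `s` that changes sign
on `[0, 1]` has exactly one zero in `(0, 1)`. -/
theorem existsUnique_rpow_add_mul_eq_zero {a b c p : ℝ} (ha : 0 < a) (hb : 0 < b) (hc : 0 < c)
    (hp : 0 < p) (habc : c < a + b) :
    ∃! s : ℝ, s ∈ Ioo (0 : ℝ) 1 ∧ a * s ^ p + b * s - c = 0 := by
  have hcont : ContinuousOn (fun s : ℝ => a * s ^ p + b * s - c) (Icc 0 1) := by
    have := Real.continuous_rpow_const hp.le
    fun_prop
  have hzero : (0 : ℝ) ∈ Ioo (a * (0 : ℝ) ^ p + b * 0 - c) (a * (1 : ℝ) ^ p + b * 1 - c) := by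
    rw [Real.zero_rpow hp.ne', Real.one_rpow]
    constructor <;> linarith
  obtain ⟨s, hs, hs0⟩ := intermediate_value_Ioo zero_le_one hcont hzero
  have hmono : StrictMonoOn (fun s : ℝ => a * s ^ p + b * s - c) (Ici 0) := by
    intro x hx y _ hxy
    have h₁ := mul_lt_mul_of_pos_left (Real.rpow_lt_rpow hx hxy hp) ha
    have h₂ := mul_lt_mul_of_pos_left hxy hb
    change a * x ^ p + b * x - c < a * y ^ p + b * y - c
    linarith
  exact ⟨s, ⟨hs, hs0⟩, fun u ⟨hu, hu0⟩ => hmono.injOn hu.1.le hs.1.le (hu0.trans hs0.symm)⟩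

theorem stmt10 (m n : ℕ) (hm : Even m) (hn : Odd n) (h2n : 2 * n < m) :
    ∃! t : ℝ, t ∈ Ioo (-1 : ℝ) 0 ∧
      ((m : ℝ) - n) * |t| ^ ((m : ℝ) / ((m : ℝ) - n)) + (2 * (n : ℝ) - m) * t - n = 0 := by
  have hn0 : (0 : ℝ) < n := by exact_mod_cast hn.pos
  have hmn : 2 * (n : ℝ) < m := by exact_mod_cast h2n
  have ha : (0 : ℝ) < m - n := by linarith
  obtain ⟨s, ⟨hs, hs0⟩, huniq⟩ := existsUnique_rpow_add_mul_eq_zero (b := m - 2 * n) ha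
    (by linarith) hn0 (div_pos (by linarith : (0 : ℝ) < m) ha) (by linarith)
  refine ⟨-s, ⟨⟨by linarith [hs.2], by linarith [hs.1]⟩, ?_⟩, ?_⟩
  · rw [abs_neg, abs_of_pos hs.1]
    linarith
  · rintro t ⟨ht, ht0⟩
    rw [abs_of_neg ht.2] at ht0
    have := huniq (-t) ⟨⟨by linarith [ht.2], by linarith [ht.1]⟩, by linarith⟩
    linarith
end

section
/- Let $m,n$ be positive integers with $m$ even, $n$ odd and $m\ge 2n$, and set $J_{m,n}=\tfrac{m}{n}(\tfrac{n}{m-n})^{(m-n)/m}$. For every $a\in(\tfrac{n}{m},1)$ such that $J_{m,n}(1-a)^{(m-n)/m}>a$, there exists a unique $c\in(-1,0)$ satisfying $J_{m,n}(1-a)^{(m-n)/m}|c|^{n/m}=1+a+c$. -/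
open Set

/-- The constant `J_{m,n} = m/n · (n/(m-n))^{(m-n)/m}`. -/
noncomputable def Jc (m n : ℕ) : ℝ :=
  (m : ℝ) / n * ((n : ℝ) / ((m : ℝ) - n)) ^ (((m : ℝ) - n) / m)

/-- If `K > a > -1` and `p > 0`, the equation `K x ^ p = 1 + a - x` has a root in `(0, 1)`. -/
lemma exists_mul_rpow_eq_sub {K a p : ℝ} (ha : -1 < a) (hK : a < K) (hp : 0 < p) :
    ∃ x ∈ Ioo (0 : ℝ) 1, K * x ^ p = 1 + a - x := by
  have hcont : ContinuousOn (fun x : ℝ => K * x ^ p + x) (Icc 0 1) :=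
    ((continuous_const.mul (Real.continuous_rpow_const hp.le)).add continuous_id).continuousOn
  obtain ⟨x, hx, hxe⟩ := intermediate_value_Ioo zero_le_one hcont
    (show 1 + a ∈ Ioo _ _ by
      simp only [Real.zero_rpow hp.ne', Real.one_rpow, mem_Ioo]
      constructor <;> linarith)
  exact ⟨x, hx, eq_sub_of_add_eq hxe⟩

theorem stmt14 (m n : ℕ) (hm : Even m) (hn : Odd n) (h2n : 2 * n ≤ m)
    (a : ℝ) (ha : a ∈ Ioo ((n : ℝ) / m) 1)
    (hJ : Jc m n * (1 - a) ^ (((m : ℝ) - n) / m) > a) :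
    ∃! c : ℝ, c ∈ Ioo (-1 : ℝ) 0 ∧
      Jc m n * (1 - a) ^ (((m : ℝ) - n) / m) * |c| ^ ((n : ℝ) / m) = 1 + a + c := by
  have hn0 : 0 < n := hn.pos
  have hm0 : 0 < m := by lia
  have hp : 0 < (n : ℝ) / m := by positivity
  have ha0 : 0 < a := hp.trans ha.1
  generalize (n : ℝ) / m = p at *
  generalize Jc m n * (1 - a) ^ (((m : ℝ) - n) / m) = K at *
  have hK : 0 < K := ha0.trans hJ
  obtain ⟨x, hx, hxe⟩ := exists_mul_rpow_eq_sub (by linarith) hJ hp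
  refine ⟨-x, ⟨⟨by linarith [hx.2], by linarith [hx.1]⟩, ?_⟩, ?_⟩
  · rw [abs_neg, abs_of_pos hx.1, hxe, sub_eq_add_neg]
  · rintro c ⟨hc, hce⟩
    rw [abs_of_neg hc.2] at hce
    have hc0 : 0 ≤ -c := by linarith [hc.2]
    rcases lt_trichotomy (-c) x with h | h | h
    · have := mul_lt_mul_of_pos_left (Real.rpow_lt_rpow hc0 h hp) hK
      linarith
    · linarith
    · have := mul_lt_mul_of_pos_left (Real.rpow_lt_rpow hx.1.le h hp) hK
      linarith
end

section
/- Let $m,n$ be positive integers with $m$ even, $n$ odd and $m\ge 2n$, and set $J_{m,n}=\tfrac{m}{n}(\tfrac{n}{m-n})^{(m-n)/m}$. Suppose $(a,c)$ and $(a',c')$ both lie in $(\tfrac{n}{m},1)\times(-1,0)$ and satisfy $J_{m,n}(1-a)^{(m-n)/m}|c|^{n/m}=1+a+c$ and $J_{m,n}(1-a')^{(m-n)/m}|c'|^{n/m}=1+a'+c'$. If $a<a'$, then $c>c'$ (the implicitly defined curve $c=\Gamma_{m,n}(a)$ is strictly decreasing). -/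
open Set

theorem Jc_nonneg {m n : ℕ} (h : n ≤ m) : 0 ≤ Jc m n := by
  have h0 : (0 : ℝ) ≤ (m : ℝ) - n := sub_nonneg.2 (by exact_mod_cast h)
  unfold Jc
  positivity

theorem stmt15 (m n : ℕ) (hm : Even m) (hn : Odd n) (h2n : 2 * n ≤ m)
    (a c a' c' : ℝ)
    (ha : a ∈ Ioo ((n : ℝ) / m) 1) (hc : c ∈ Ioo (-1 : ℝ) 0)
    (ha' : a' ∈ Ioo ((n : ℝ) / m) 1) (hc' : c' ∈ Ioo (-1 : ℝ) 0)
    (heq : Jc m n * (1 - a) ^ (((m : ℝ) - n) / m) * |c| ^ ((n : ℝ) / m) = 1 + a + c)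
    (heq' : Jc m n * (1 - a') ^ (((m : ℝ) - n) / m) * |c'| ^ ((n : ℝ) / m) = 1 + a' + c')
    (hlt : a < a') :
    c' < c := by
  by_contra! h
  have hnm : (n : ℝ) ≤ m := by exact_mod_cast (by omega : n ≤ m)
  have hexp : 0 ≤ ((m : ℝ) - n) / m := div_nonneg (sub_nonneg.2 hnm) m.cast_nonneg
  have hJ : 0 ≤ Jc m n := Jc_nonneg (by omega)
  have hu' : 0 ≤ 1 - a' := by linarith [ha'.2]
  have hu : 0 ≤ 1 - a := by linarith
  have hu_le : 1 - a' ≤ 1 - a := by linarith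
  have hx : |c'| ≤ |c| := by
    rw [abs_of_neg hc.2, abs_of_neg hc'.2]
    linarith
  have key : Jc m n * (1 - a') ^ (((m : ℝ) - n) / m) * |c'| ^ ((n : ℝ) / m) ≤
      Jc m n * (1 - a) ^ (((m : ℝ) - n) / m) * |c| ^ ((n : ℝ) / m) := by
    gcongr
  linarith
end

section
/- Let $m,n$ be positive integers with $m$ even, $n$ odd and $m\ge 2n$, and set $J_{m,n}=\tfrac{m}{n}(\tfrac{n}{m-n})^{(m-n)/m}$. Let $a_1\in(\tfrac{n}{m},1)$ be such that $c_1:=\tfrac{n}{m-n}a_1-1$ lies in $(-1,0)$ and $J_{m,n}(1-a_1)^{(m-n)/m}|c_1|^{n/m}=1+a_1+c_1$. Then for every $a\in[\tfrac{n}{m},a_1]$ and every $c\in[-1,0)$ satisfying $J_{m,n}(1-a)^{(m-n)/m}|c|^{n/m}=1+a+c$, the two points $\pm\big(a,\ 1-|a+c|,\ c\big)$ are extreme points of the unit ball $\mathsf{B}^h_{m,n}$. -/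
open Set

/-- Weighted AM-GM inequality in the normalization given by `Jc`. -/
theorem Jc_mul_le_add {m n : ℕ} (hn : 0 < n) (hnm : n < m) {A B : ℝ} (hA : 0 ≤ A) (hB : 0 ≤ B) :
    Jc m n * A ^ (((m : ℝ) - n) / m) * B ^ ((n : ℝ) / m) ≤ A + B := by
  have hn' : (0 : ℝ) < n := by exact_mod_cast hn
  have hk : (0 : ℝ) < m - n := sub_pos.2 (by exact_mod_cast hnm)
  have hm' : (0 : ℝ) < m := by linarith
  have key := Real.geom_mean_le_arith_mean2_weighted
    (w₁ := ((m : ℝ) - n) / m) (w₂ := (n : ℝ) / m) (p₁ := n / (m - n) * A * (m / n))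
    (p₂ := m / n * B) (by positivity) (by positivity) (by positivity) (by positivity)
    (by field_simp; ring)
  have e : ((m : ℝ) - n) / m * (n / (m - n) * A * (m / n)) + n / m * (m / n * B) = A + B := by
    field_simp
  rw [e, Real.mul_rpow (by positivity) (by positivity), Real.mul_rpow (by positivity) hA,
    Real.mul_rpow (by positivity) hB] at key
  have e2 : ((m : ℝ) / n) ^ (((m : ℝ) - n) / m) * ((m : ℝ) / n) ^ ((n : ℝ) / m) = m / n := by
    rw [← Real.rpow_add (by positivity)]
    have : ((m : ℝ) - n) / m + n / m = 1 := by field_simp; ring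
    rw [this, Real.rpow_one]
  refine le_trans (le_of_eq ?_) key
  unfold Jc
  linear_combination (-((n : ℝ) / (m - n)) ^ (((m : ℝ) - n) / m) * A ^ (((m : ℝ) - n) / m)
    * B ^ ((n : ℝ) / m)) * e2

/-- The equality case of `Jc_mul_le_add`. -/
theorem Jc_mul_eq_add {m n : ℕ} (hn : 0 < n) (hnm : n < m) {A B : ℝ} (hA : 0 ≤ A) (hB : 0 ≤ B)
    (hAB : (n : ℝ) * A = (m - n) * B) :
    Jc m n * A ^ (((m : ℝ) - n) / m) * B ^ ((n : ℝ) / m) = A + B := by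
  have hn' : (0 : ℝ) < n := by exact_mod_cast hn
  have hk : (0 : ℝ) < m - n := sub_pos.2 (by exact_mod_cast hnm)
  have hm' : (0 : ℝ) < m := by linarith
  have e : B = n / (m - n) * A := by field_simp; linarith
  have hB1 : B ^ (((m : ℝ) - n) / m) * B ^ ((n : ℝ) / m) = B := by
    rw [← Real.rpow_add_of_nonneg hB (by positivity) (by positivity)]
    have : ((m : ℝ) - n) / m + n / m = 1 := by field_simp; ring
    rw [this, Real.rpow_one]
  have hB2 : ((n : ℝ) / (m - n)) ^ (((m : ℝ) - n) / m) * A ^ (((m : ℝ) - n) / m)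
      = B ^ (((m : ℝ) - n) / m) := by
    rw [← Real.mul_rpow (by positivity) hA, e]
  have : Jc m n * A ^ (((m : ℝ) - n) / m) * B ^ ((n : ℝ) / m)
      = m / n * (B ^ (((m : ℝ) - n) / m) * B ^ ((n : ℝ) / m)) := by
    rw [← hB2]; unfold Jc; ring
  rw [this, hB1]
  field_simp
  linarith

theorem mul_pow_rpow_div {m j : ℕ} (hm : m ≠ 0) {A x : ℝ} (hA : 0 ≤ A) (hx : 0 ≤ x) :
    (A * x ^ m) ^ ((j : ℝ) / m) = A ^ ((j : ℝ) / m) * x ^ j := by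
  have hm' : (m : ℝ) ≠ 0 := by exact_mod_cast hm
  rw [Real.mul_rpow hA (by positivity), ← Real.rpow_natCast x m, ← Real.rpow_mul hx,
    mul_div_cancel₀ _ hm', Real.rpow_natCast]

theorem mem_homBall_iff {m n : ℕ} {p : ℝ × ℝ × ℝ} :
    p ∈ homBall m n ↔ ∀ x ∈ Icc (-1 : ℝ) 1, ∀ y ∈ Icc (-1 : ℝ) 1,
      |p.1 * x ^ m + p.2.1 * x ^ (m - n) * y ^ n + p.2.2 * y ^ m| ≤ 1 := by
  have hb : BddAbove ((fun q : ℝ × ℝ => |p.1 * q.1 ^ m + p.2.1 * q.1 ^ (m - n) * q.2 ^ n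
      + p.2.2 * q.2 ^ m|) '' (Icc (-1 : ℝ) 1 ×ˢ Icc (-1 : ℝ) 1)) :=
    ((isCompact_Icc.prod isCompact_Icc).image (by fun_prop)).bddAbove
  constructor
  · intro h x hx y hy
    exact (le_csSup hb ⟨(x, y), ⟨hx, hy⟩, rfl⟩).trans h
  · intro h
    have h0 : (0 : ℝ) ∈ Icc (-1 : ℝ) 1 := by simp
    change homNorm m n p.1 p.2.1 p.2.2 ≤ 1
    unfold homNorm
    refine csSup_le ⟨_, (0, 0), ⟨h0, h0⟩, rfl⟩ ?_
    rintro _ ⟨⟨x, y⟩, ⟨hx, hy⟩, rfl⟩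
    exact h x hx y hy

theorem neg_mem_homBall {m n : ℕ} {p : ℝ × ℝ × ℝ} (hp : p ∈ homBall m n) : -p ∈ homBall m n := by
  rw [mem_homBall_iff] at hp ⊢
  intro x hx y hy
  rw [← abs_neg]
  refine (congrArg abs ?_).trans_le (hp x hx y hy)
  simp only [Prod.fst_neg, Prod.snd_neg]
  ring

theorem neg_mem_extremePoints_homBall {m n : ℕ} {p : ℝ × ℝ × ℝ}
    (hp : p ∈ Set.extremePoints ℝ (homBall m n)) : -p ∈ Set.extremePoints ℝ (homBall m n) := by
  rw [mem_extremePoints] at hp ⊢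
  refine ⟨neg_mem_homBall hp.1, fun u hu v hv ⟨α, β, hα, hβ, hαβ, h⟩ => ?_⟩
  have := hp.2 (-u) (neg_mem_homBall hu) (-v) (neg_mem_homBall hv)
    ⟨α, β, hα, hβ, hαβ, by rw [smul_neg, smul_neg, ← neg_add, h, neg_neg]⟩
  exact ⟨neg_eq_iff_eq_neg.1 this.1, neg_eq_iff_eq_neg.1 this.2⟩

/-- At a maximum over `[0, 1]` attained at a positive point, a trinomial is nondecreasing. -/
theorem trinomial_deriv_nonneg_of_max {m n : ℕ} (hn : 0 < n) (hm : 0 < m) {a b c M t : ℝ}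
    (ht : t ∈ Icc (0 : ℝ) 1)
    (h : ∀ y ∈ Icc (0 : ℝ) 1, a + b * y ^ n + c * y ^ m ≤ M)
    (hM : a + b * t ^ n + c * t ^ m = M) :
    0 ≤ n * b * t ^ n + m * c * t ^ m := by
  have hd : HasDerivAt (fun y : ℝ => a + b * y ^ n + c * y ^ m)
      (b * (n * t ^ (n - 1)) + c * (m * t ^ (m - 1))) t :=
    (((hasDerivAt_pow n t).const_mul b).const_add a).add ((hasDerivAt_pow m t).const_mul c)
  have hmax : IsLocalMaxOn (fun y : ℝ => a + b * y ^ n + c * y ^ m) (Icc 0 1) t :=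
    IsMaxOn.localize fun y hy => by
      simpa [hM] using h y hy
  have hcone : (0 : ℝ) - t ∈ posTangentConeAt (Icc (0 : ℝ) 1) t :=
    sub_mem_posTangentConeAt_of_segment_subset
      ((convex_Icc (0 : ℝ) 1).segment_subset ht (by simp))
  have := hmax.hasFDerivWithinAt_nonpos hd.hasFDerivAt.hasFDerivWithinAt hcone
  simp at this
  rw [← mul_pow_sub_one hn.ne' t, ← mul_pow_sub_one hm.ne' t]
  linarith

/-- A trinomial of norm at most one is an extreme point of the unit ball as soon as it takes the
value `-1` at `(1, -1)` and attains the value `1` at an interior critical point `(1, t)`. -/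
theorem mem_extremePoints_homBall_of_contact {m n : ℕ} (hm : Even m) (hn : Odd n) (hnm : n < m)
    {a b c t : ℝ} (hmem : (a, b, c) ∈ homBall m n) (ht : 0 < t) (ht1 : t ≤ 1)
    (hneg : a - b + c = -1) (hval : a + b * t ^ n + c * t ^ m = 1)
    (hder : n * b * t ^ n + m * c * t ^ m = 0) :
    (a, b, c) ∈ Set.extremePoints ℝ (homBall m n) := by
  have hn0 : 0 < n := hn.pos
  have hbounds : ∀ u ∈ homBall m n, -1 ≤ u.1 - u.2.1 + u.2.2 ∧
      ∀ y ∈ Icc (0 : ℝ) 1, u.1 + u.2.1 * y ^ n + u.2.2 * y ^ m ≤ 1 := by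
    intro u hu
    rw [mem_homBall_iff] at hu
    constructor
    · have := (abs_le.1 (hu 1 (by simp) (-1) (by simp))).1
      rw [hn.neg_one_pow, hm.neg_one_pow] at this
      simp only [one_pow] at this
      linarith
    · intro y hy
      have := (abs_le.1 (hu 1 (by simp) y ⟨by linarith [hy.1], hy.2⟩)).2
      simpa using this
  have htn : 0 < t ^ n := by positivity
  have htm : 0 < t ^ m := by positivity
  have hnR : (0 : ℝ) < n := by exact_mod_cast hn0
  have hnmR : (n : ℝ) < m := by exact_mod_cast hnm
  have huniq : ∀ a' b' c' : ℝ, a' - b' + c' = -1 → a' + b' * t ^ n + c' * t ^ m = 1 →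
      n * b' * t ^ n + m * c' * t ^ m = 0 → (a', b', c') = (a, b, c) := by
    intro a' b' c' h1 h2 h3
    have hpos : 0 < ((m : ℝ) - n) * t ^ m * t ^ n + m * t ^ m + n * t ^ n := by
      have : 0 < (m : ℝ) - n := by linarith
      have : (0 : ℝ) < m := by linarith
      positivity
    have hc : (c' - c) * (((m : ℝ) - n) * t ^ m * t ^ n + m * t ^ m + n * t ^ n) = 0 := by
      linear_combination (n * t ^ n) * (h1 - hneg) - (n * t ^ n) * (h2 - hval)
        + (1 + t ^ n) * (h3 - hder)
    have hc' : c' = c := by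
      rcases mul_eq_zero.1 hc with h | h
      · linarith
      · exact absurd h hpos.ne'
    subst hc'
    have hb : b' = b := by
      have : (b' - b) * (n * t ^ n) = 0 := by linear_combination h3 - hder
      rcases mul_eq_zero.1 this with h | h
      · linarith
      · exact absurd h (by positivity)
    subst hb
    have : a' = a := by linarith
    rw [this]
  rw [mem_extremePoints]
  refine ⟨hmem, ?_⟩
  rintro ⟨a₁, b₁, c₁⟩ hu ⟨a₂, b₂, c₂⟩ hv ⟨α, β, hα, hβ, hαβ, h⟩
  obtain ⟨hu1, hu2⟩ := hbounds _ hu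
  obtain ⟨hv1, hv2⟩ := hbounds _ hv
  simp only [Prod.smul_mk, Prod.mk_add_mk, Prod.mk.injEq, smul_eq_mul] at h hu1 hu2 hv1 hv2
  obtain ⟨ha, hb, hc⟩ := h
  have htI : t ∈ Icc (0 : ℝ) 1 := ⟨ht.le, ht1⟩
  have eq_of_avg : ∀ {p q M : ℝ}, M ≤ p → M ≤ q → α * p + β * q = M → p = M ∧ q = M := by
    intro p q M hp hq hM
    have h0 : α * (p - M) + β * (q - M) = 0 := by linear_combination hM - M * hαβ
    have h1 := mul_nonneg hα.le (sub_nonneg.2 hp)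
    have h2 := mul_nonneg hβ.le (sub_nonneg.2 hq)
    have h3 : α * (p - M) = 0 := by linarith
    have h4 : β * (q - M) = 0 := by linarith
    rcases mul_eq_zero.1 h3 with h | h <;> rcases mul_eq_zero.1 h4 with h' | h' <;>
      constructor <;> linarith
  obtain ⟨n1, n2⟩ := eq_of_avg hu1 hv1 (by rw [← hneg, ← ha, ← hb, ← hc]; ring)
  obtain ⟨v1, v2⟩ := eq_of_avg (neg_le_neg (hu2 t htI)) (neg_le_neg (hv2 t htI))
    (by rw [← hval, ← ha, ← hb, ← hc]; ring)
  replace v1 := neg_injective v1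
  replace v2 := neg_injective v2
  obtain ⟨d1, d2⟩ := eq_of_avg
    (trinomial_deriv_nonneg_of_max hn0 (hn0.trans hnm) htI hu2 v1)
    (trinomial_deriv_nonneg_of_max hn0 (hn0.trans hnm) htI hv2 v2)
    (by rw [← hder, ← hb, ← hc]; ring)
  exact ⟨huniq _ _ _ n1 v1 d1, huniq _ _ _ n2 v2 d2⟩

/-- Weighted AM-GM inequality for a monomial of degree `m`. -/
theorem pow_sub_mul_pow_le {m n : ℕ} (hnm : n < m) {x y : ℝ} (hx : 0 ≤ x) (hy : 0 ≤ y) :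
    m * (x ^ (m - n) * y ^ n) ≤ ((m : ℝ) - n) * x ^ m + n * y ^ m := by
  have hk : (0 : ℝ) < m - n := sub_pos.2 (by exact_mod_cast hnm)
  have hm : m ≠ 0 := by omega
  have hm' : (0 : ℝ) < m := by positivity
  have key := Real.geom_mean_le_arith_mean2_weighted
    (w₁ := ((m : ℝ) - n) / m) (w₂ := (n : ℝ) / m) (p₁ := 1 * x ^ m)
    (p₂ := 1 * y ^ m) (by positivity) (by positivity) (by positivity) (by positivity)
    (by field_simp; ring)
  rw [← Nat.cast_sub hnm.le, mul_pow_rpow_div hm zero_le_one hx,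
    mul_pow_rpow_div hm zero_le_one hy, Real.one_rpow, Real.one_rpow, Nat.cast_sub hnm.le] at key
  calc (m : ℝ) * (x ^ (m - n) * y ^ n)
      ≤ m * (((m : ℝ) - n) / m * (1 * x ^ m) + n / m * (1 * y ^ m)) := by
        gcongr; simpa using key
    _ = _ := by field_simp

/-- A sufficient condition for a trinomial to lie in the unit ball. -/
theorem mem_homBall_of_le {m n : ℕ} (hm : Even m) (hn : 0 < n) (hnm : n < m) {a b s : ℝ}
    (ha1 : a ≤ 1) (hs : 0 ≤ s) (hb : 0 ≤ b)
    (hJ : b ≤ Jc m n * (1 - a) ^ (((m : ℝ) - n) / m) * s ^ ((n : ℝ) / m))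
    (hline : m * a ≤ ((m : ℝ) - n) * b) (hsum : b + s - a ≤ 1) :
    (a, b, -s) ∈ homBall m n := by
  rw [mem_homBall_iff]
  intro x hx y hy
  have hm0 : m ≠ 0 := by omega
  have hmR : (0 : ℝ) < m := by positivity
  have hX1 : |x| ≤ 1 := abs_le.2 hx
  have hY1 : |y| ≤ 1 := abs_le.2 hy
  have hX := abs_nonneg x
  have hY := abs_nonneg y
  have hXm : |x| ^ m ≤ 1 := pow_le_one₀ hX hX1
  have hYm : |y| ^ m ≤ 1 := pow_le_one₀ hY hY1
  have hXm0 : 0 ≤ |x| ^ m := by positivity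
  have hYm0 : 0 ≤ |y| ^ m := by positivity
  have hup : b * (|x| ^ (m - n) * |y| ^ n) ≤ (1 - a) * |x| ^ m + s * |y| ^ m := by
    refine le_trans ?_ (Jc_mul_le_add hn hnm (mul_nonneg (sub_nonneg.2 ha1) hXm0)
      (mul_nonneg hs hYm0))
    rw [← Nat.cast_sub hnm.le, mul_pow_rpow_div hm0 (sub_nonneg.2 ha1) hX,
      mul_pow_rpow_div hm0 hs hY, Nat.cast_sub hnm.le]
    calc _ ≤ Jc m n * (1 - a) ^ (((m : ℝ) - n) / m) * s ^ ((n : ℝ) / m)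
          * (|x| ^ (m - n) * |y| ^ n) := by gcongr
      _ = _ := by ring
  have hlow : -1 ≤ a * |x| ^ m - b * (|x| ^ (m - n) * |y| ^ n) - s * |y| ^ m := by
    have h1 := mul_le_mul_of_nonneg_left (pow_sub_mul_pow_le hnm hX hY) hb
    have h2 := mul_nonneg (sub_nonneg.2 hline) (sub_nonneg.2 hXm)
    have hq : 0 ≤ n * b + m * s := by positivity
    have h3 := mul_nonneg hq (sub_nonneg.2 hYm)
    have h4 := mul_le_mul_of_nonneg_left hsum hmR.le
    refine le_of_mul_le_mul_left ?_ hmR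
    linarith
  have habs : |b * (x ^ (m - n) * y ^ n)| = b * (|x| ^ (m - n) * |y| ^ n) := by
    rw [abs_mul, abs_mul, abs_pow, abs_pow, abs_of_nonneg hb]
  have h5 := abs_le.1 habs.le
  rw [← hm.pow_abs x, ← hm.pow_abs y, abs_le]
  constructor
  · linarith [h5.1]
  · linarith [h5.2]

theorem stmt19 (m n : ℕ) (hm : Even m) (hn : Odd n) (h2n : 2 * n ≤ m)
    (a1 : ℝ) (ha1 : a1 ∈ Ioo ((n : ℝ) / m) 1)
    (hc1 : (n : ℝ) / ((m : ℝ) - n) * a1 - 1 ∈ Ioo (-1 : ℝ) 0)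
    (hcurve : Jc m n * (1 - a1) ^ (((m : ℝ) - n) / m) *
        |(n : ℝ) / ((m : ℝ) - n) * a1 - 1| ^ ((n : ℝ) / m) =
      1 + a1 + ((n : ℝ) / ((m : ℝ) - n) * a1 - 1))
    (a c : ℝ) (ha : a ∈ Icc ((n : ℝ) / m) a1) (hc : c ∈ Ico (-1 : ℝ) 0)
    (hac : Jc m n * (1 - a) ^ (((m : ℝ) - n) / m) * |c| ^ ((n : ℝ) / m) = 1 + a + c) :
    ∀ ε ∈ ({-1, 1} : Set ℝ),
      (ε * a, ε * (1 - |a + c|), ε * c) ∈ Set.extremePoints ℝ (homBall m n) := by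
  have hn0 : 0 < n := hn.pos
  have hnm : n < m := by omega
  have hnR : (0 : ℝ) < n := by exact_mod_cast hn0
  have hk : (0 : ℝ) < m - n := sub_pos.2 (by exact_mod_cast hnm)
  have hmR : (0 : ℝ) < m := by linarith
  have ha_lt : a < 1 := ha.2.trans_lt ha1.2
  have ha_pos : 0 < a := (by positivity : (0 : ℝ) < n / m).trans_le ha.1
  obtain ⟨s, rfl⟩ : ∃ s, c = -s := ⟨-c, by ring⟩
  have hs : 0 < s := by linarith [hc.2]
  rw [abs_neg, abs_of_pos hs] at hac
  have has : a ≤ s := by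
    have := Jc_mul_le_add hn0 hnm (sub_nonneg.2 ha_lt.le) hs.le
    linarith
  have hJ : 0 ≤ Jc m n := by unfold Jc; positivity
  have hline : s ≤ 1 - n / (m - n) * a := by
    by_contra! hlt
    have hle : (n : ℝ) / (m - n) * a ≤ n / (m - n) * a1 := by gcongr; exact ha.2
    have hs1 : |(n : ℝ) / (m - n) * a1 - 1| < s := by
      rw [abs_of_neg hc1.2]; linarith
    have : Jc m n * (1 - a1) ^ (((m : ℝ) - n) / m) *
        |(n : ℝ) / ((m : ℝ) - n) * a1 - 1| ^ ((n : ℝ) / m) ≤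
        Jc m n * (1 - a) ^ (((m : ℝ) - n) / m) * s ^ ((n : ℝ) / m) := by
      have := ha1.2
      have := ha.2
      gcongr
    rw [abs_of_neg hc1.2] at hs1
    linarith [ha.2]
  have hline' : m * a ≤ ((m : ℝ) - n) * (1 + a - s) := by
    have := mul_le_mul_of_nonneg_left hline hk.le
    have e : ((m : ℝ) - n) * (1 - n / (m - n) * a) = m - n - n * a := by field_simp
    linarith
  have hb : 0 ≤ 1 + a - s := by
    by_contra! h
    have := mul_neg_of_pos_of_neg hk h
    have : 0 < m * a := by positivity
    linarith
  have hmem : (a, 1 + a - s, -s) ∈ homBall m n :=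
    mem_homBall_of_le hm hn0 hnm ha_lt.le hs.le hb (by linarith) hline' (by linarith)
  have hq : (0 : ℝ) < n * (1 - a) / ((m - n) * s) := by
    have : 0 < 1 - a := by linarith
    positivity
  obtain ⟨t, ht, htm⟩ : ∃ t : ℝ, 0 < t ∧ t ^ m = n * (1 - a) / ((m - n) * s) :=
    ⟨_, Real.rpow_pos_of_pos hq _, Real.rpow_inv_natCast_pow hq.le (by omega)⟩
  have hcrit : (n : ℝ) * (1 - a) = (m - n) * (s * t ^ m) := by rw [htm]; field_simp
  have ht1 : t ≤ 1 := by
    refine (pow_le_one_iff_of_nonneg ht.le (by omega : m ≠ 0)).1 ?_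
    rw [htm, div_le_one (by positivity)]
    have h1 : (n : ℝ) ≤ m * a := by
      have := (div_le_iff₀ hmR).1 ha.1
      linarith
    have := mul_le_mul_of_nonneg_left has hk.le
    linarith
  have htouch : (1 + a - s) * t ^ n = 1 - a + s * t ^ m := by
    rw [← Jc_mul_eq_add hn0 hnm (sub_nonneg.2 ha_lt.le) (by positivity) hcrit,
      mul_pow_rpow_div (by omega) hs.le ht.le]
    linear_combination (-t ^ n) * hac
  have hext : (a, 1 + a - s, -s) ∈ Set.extremePoints ℝ (homBall m n) :=
    mem_extremePoints_homBall_of_contact hm hn hnm hmem ht ht1 (by ring)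
      (by linear_combination htouch) (by linear_combination n * htouch + hcrit)
  have hbe : 1 - |a + -s| = 1 + a - s := by
    rw [abs_of_nonpos (by linarith)]; ring
  intro ε hε
  rw [hbe]
  rcases hε with rfl | rfl
  · simpa using neg_mem_extremePoints_homBall hext
  · simpa using hext
end
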